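/- arXiv:math/0105015 — 5 statements merged into one kernel-verified Lean document; each statement's English description precedes it below -/
import Mathlib

section
/- Every flexible C-loop is an ARIF loop. -/
/-- A loop: a magma with two-sided identity and left/right division. -/
class Loop (M : Type*) extends Mul M, One M where
  ld : M → M → M
  rd : M → M → M
  mul_ld : ∀ x y : M, x * ld x y = y
  ld_mul : ∀ x y : M, ld x (x * y) = y
  rd_mul : ∀ x y : M, rd y x * x = y
  mul_rd : ∀ x y : M, rd (y * x) x = y
  one_mul : ∀ x : M, 1 * x = x
  mul_one : ∀ x : M, x * 1 = x

/-- Every flexible C-loop is an ARIF loop: it satisfies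
`W1 : R(x)R(yxy) = R(xyx)R(y)` and `W2 : L(x)L(yxy) = L(xyx)L(y)` (pointwise). -/
theorem flexible_c_loop_is_arif {M : Type*} [Loop M]
    (hflex : ∀ x y : M, x * (y * x) = (x * y) * x)
    (hC : ∀ x y z : M, ((x * y) * y) * z = x * (y * (y * z))) :
    (∀ x y z : M, (z * x) * (y * (x * y)) = (z * (x * (y * x))) * y) ∧
      (∀ x y z : M, (y * (x * y)) * (x * z) = y * ((x * (y * x)) * z)) := by
  -- alternativity
  have ra : ∀ x y : M, (x * y) * y = x * (y * y) := fun x y => by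
    have := hC x y 1
    simpa only [Loop.mul_one] using this
  have la : ∀ y z : M, (y * y) * z = y * (y * z) := fun y z => by
    have := hC 1 y z
    simpa only [Loop.one_mul] using this
  -- inverse property
  have r1 : ∀ a b : M, a * b = 1 → ∀ w, (w * a) * b = w := fun a b h w => by
    have := hC (Loop.rd w a) a b
    rw [h, Loop.mul_one, Loop.rd_mul] at this
    exact this
  have l1 : ∀ a b : M, a * b = 1 → ∀ w, a * (b * w) = w := fun a b h w => by
    have := hC a b (Loop.ld b w)
    rw [h, Loop.one_mul, Loop.mul_ld] at this
    exact this.symm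
  have cm : ∀ a b : M, a * b = 1 → b * a = 1 := fun a b h => by
    have h1 := l1 a b h a
    have h2 := congrArg (Loop.ld a) h1
    rw [Loop.ld_mul] at h2
    rw [h2, ← Loop.ld_mul a 1, Loop.mul_one]
  have ex : ∀ y : M, ∃ z : M, y * z = 1 ∧ z * y = 1 := fun y =>
    ⟨Loop.ld y 1, Loop.mul_ld y 1, cm _ _ (Loop.mul_ld y 1)⟩
  -- squares are in the nucleus
  have mn : ∀ x y z : M, (x * (y * y)) * z = x * ((y * y) * z) := fun x y z => by
    rw [← ra, la, hC]
  have ln : ∀ y x z : M, ((y * y) * x) * z = (y * y) * (x * z) := fun y x z => by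
    obtain ⟨i, hi, hi'⟩ := ex y
    obtain ⟨j, hj, hj'⟩ := ex x
    have e : ∀ w, (i * i) * ((y * y) * w) = w := fun w => by
      rw [la, la, l1 i y hi', l1 i y hi']
    have h1 : (j * (i * i)) * ((y * y) * x) = 1 := by rw [mn, e, hj']
    have h2 : (j * (i * i)) * ((y * y) * (x * z)) = z := by rw [mn, e, l1 j x hj']
    have h3 := l1 _ _ (cm _ _ h1) ((y * y) * (x * z))
    rwa [h2] at h3
  have rn : ∀ y x z : M, (z * x) * (y * y) = z * (x * (y * y)) := fun y x z => by
    obtain ⟨i, hi, hi'⟩ := ex y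
    obtain ⟨j, hj, hj'⟩ := ex x
    have e : ∀ w, (y * y) * ((i * i) * w) = w := fun w => by
      rw [la, la, l1 y i hi, l1 y i hi]
    have h1 : (x * (y * y)) * ((i * i) * j) = 1 := by rw [mn, e, hj]
    have h2 : ((z * x) * (y * y)) * ((i * i) * j) = z := by rw [mn, e, r1 x j hj]
    have h3 := r1 _ _ (cm _ _ h1) ((z * x) * (y * y))
    rw [h2] at h3
    exact h3.symm
  -- two expressions for `y x y`
  have A : ∀ x y i : M, x * i = 1 → y * (x * y) = ((y * x) * (y * x)) * i := fun x y i h => by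
    rw [la, r1 x i h, hflex]
  have B : ∀ x y i : M, x * i = 1 → y * (x * y) = i * ((x * y) * (x * y)) := fun x y i h => by
    rw [← ra, l1 i x (cm _ _ h)]
  have K : ∀ x y : M, ((y * x) * (y * x)) * y = y * ((x * y) * (x * y)) := fun x y => by
    obtain ⟨j, hj, hj'⟩ := ex y
    have h := (A y x j hj).symm.trans (B y x j hj)
    have h2 : y * (((x * y) * (x * y)) * j) = (y * x) * (y * x) := by
      rw [h, l1 y j hj]
    rw [← h2, ← mn, r1 j y hj']
  refine ⟨fun x y z => ?_, fun x y z => ?_⟩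
  · obtain ⟨i, hi, hi'⟩ := ex x
    obtain ⟨j, hj, hj'⟩ := ex y
    rw [B x y i hi, B y x j hj, ← rn, r1 x i hi, ← rn, mn, K, ← rn, r1 j y hj']
  · obtain ⟨i, hi, hi'⟩ := ex x
    obtain ⟨j, hj, hj'⟩ := ex y
    rw [A x y i hi, A y x j hj, ln, l1 i x hi', ln, ← mn, ← K, ln, l1 y j hj]
end

section
/- An ARIF loop in which every element is a square is a Moufang loop. -/
/-- An ARIF loop in which every element is a square is a Moufang loop. -/
theorem arif_squares_moufang {M : Type*} [Loop M]
    (hflex : ∀ x y : M, x * (y * x) = (x * y) * x)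
    (hW1 : ∀ x y z : M, (z * x) * (y * (x * y)) = (z * (x * (y * x))) * y)
    (hW2 : ∀ x y z : M, (y * (x * y)) * (x * z) = y * ((x * (y * x)) * z))
    (hsq : ∀ z : M, ∃ y : M, z = y * y) :
    ∀ x y z : M, ((x * y) * z) * y = x * (y * (z * y)) := by
  have one_mul : ∀ x : M, 1 * x = x := Loop.one_mul
  have mul_one : ∀ x : M, x * 1 = x := Loop.mul_one
  have lcan : ∀ x y z : M, x * y = x * z → y = z := fun x y z h => by
    rw [← Loop.ld_mul x y, h, Loop.ld_mul]
  have rcan : ∀ x y z : M, y * x = z * x → y = z := fun x y z h => by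
    rw [← Loop.mul_rd x y, h, Loop.mul_rd]
  -- alternativity
  have ralt : ∀ z x : M, (z * x) * x = z * (x * x) := fun z x => by
    have h := hW1 x 1 z
    simpa only [one_mul, mul_one] using h
  have lalt : ∀ x z : M, x * (x * z) = (x * x) * z := fun x z => by
    have h := hW2 x 1 z
    simpa only [one_mul, mul_one] using h
  -- two-sided inverses
  have hinv : ∀ x : M, ∃ x' : M, x * x' = 1 ∧ x' * x = 1 := fun x => by
    refine ⟨Loop.ld x 1, Loop.mul_ld x 1, ?_⟩
    apply lcan x
    rw [hflex, Loop.mul_ld, one_mul, mul_one]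
  -- inverse properties
  have lip : ∀ x x' v : M, x' * x = 1 → x' * (x * v) = v := fun x x' v h => by
    have h1 := hW1 x (Loop.rd v x) x'
    rw [h, one_mul, hflex (Loop.rd v x) x, Loop.rd_mul] at h1
    exact (rcan _ _ _ h1).symm
  have rip : ∀ x x' v : M, x * x' = 1 → (v * x) * x' = v := fun x x' v h => by
    have h1 := hW2 x (Loop.ld x v) x'
    rw [h, mul_one, hflex x (Loop.ld x v), Loop.mul_ld] at h1
    exact (lcan _ _ _ h1).symm
  intro z x d
  obtain ⟨a, ha⟩ := hsq (x * d)
  obtain ⟨x', h1, h2⟩ := hinv x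
  have e1 := hW1 x (x' * a) z
  rw [lip x' x a h1, ralt, ← ha, lip x x' d h2, hflex x (x' * a), lip x' x a h1] at e1
  have e2 := hW1 (a * x) x' z
  rw [rip x x' a h1, hflex (a * x) x' , rip x x' a h1, lalt, ← ha] at e2
  rw [e1, e2, rip x' x _ h2, hflex x d]
end

section
/- Every finite ARIF loop of odd order is a Moufang loop. -/
/-- Every finite ARIF loop of odd order is a Moufang loop. -/
theorem finite_odd_arif_moufang {M : Type*} [Loop M] [Fintype M]
    (hodd : Odd (Fintype.card M))
    (hflex : ∀ x y : M, x * (y * x) = (x * y) * x)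
    (hW1 : ∀ x y z : M, (z * x) * (y * (x * y)) = (z * (x * (y * x))) * y)
    (hW2 : ∀ x y z : M, (y * (x * y)) * (x * z) = y * ((x * (y * x)) * z)) :
    ∀ x y z : M, ((x * y) * z) * y = x * (y * (z * y)) := by
  classical
  have one_mul' : ∀ x : M, 1 * x = x := Loop.one_mul
  have mul_one' : ∀ x : M, x * 1 = x := Loop.mul_one
  have lc : ∀ x y z : M, x * y = x * z → y = z := fun x y z h => by
    rw [← Loop.ld_mul x y, h, Loop.ld_mul]
  have rc : ∀ x y z : M, y * x = z * x → y = z := fun x y z h => by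
    rw [← Loop.mul_rd x y, h, Loop.mul_rd]
  obtain ⟨i, hi⟩ : ∃ i : M → M, ∀ x, x * i x = 1 :=
    ⟨fun x => Loop.ld x 1, fun x => Loop.mul_ld x 1⟩
  have hi' : ∀ x, i x * x = 1 := fun x => by
    apply lc x
    rw [hflex, hi, one_mul', mul_one']
  -- inverse properties
  have lip : ∀ x w : M, i x * (x * w) = w := fun x w => by
    have h := hW1 x (Loop.rd w x) (i x)
    rw [hi', one_mul', hflex (Loop.rd w x) x, Loop.rd_mul] at h
    exact (rc _ _ _ h).symm
  have rip : ∀ x w : M, (w * x) * i x = w := fun x w => by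
    have h := hW2 x (Loop.ld x w) (i x)
    rw [hi, mul_one', hflex x, Loop.mul_ld] at h
    exact (lc _ _ _ h).symm
  have ii : ∀ x, i (i x) = x := fun x => lc (i x) _ _ (by rw [hi, hi'])
  have lip' : ∀ x w : M, x * (i x * w) = w := fun x w => by
    have := lip (i x) w
    rwa [ii] at this
  have rip' : ∀ x w : M, (w * i x) * x = w := fun x w => by
    have := rip (i x) w
    rwa [ii] at this
  have imul : ∀ x y : M, i (x * y) = i y * i x := fun x y => by
    have h := lip (x * y) (i y)
    rw [rip] at h
    rw [← h, rip]
  have lalt : ∀ x y : M, (x * x) * y = x * (x * y) := fun x y => by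
    have h := hW2 1 x y
    simpa only [one_mul', mul_one'] using h
  -- right translations as permutations
  let R : M → Equiv.Perm M := fun x => ⟨fun z => z * x, fun z => z * i x, rip x, rip' x⟩
  have Rap : ∀ x z, R x z = z * x := fun _ _ => rfl
  have Rinv : ∀ x, R (i x) = (R x)⁻¹ := fun x => by
    ext z
    rfl
  have W : ∀ x y, R (y * (x * y)) * R x = R y * R (x * (y * x)) := fun x y => by
    ext z
    exact hW1 x y z
  have A : ∀ u y, R (u * (u * y)) = R y * R (i y * u) * R (u * y) := fun u y => by
    have h := W (u * y) (i y)
    rw [rip, hflex (u * y), rip, Rinv y] at h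
    rw [mul_assoc, h, mul_inv_cancel_left]
  have C : ∀ v y, R (v * (v * (v * y))) = R (v * y) * R (i y * v) * R (v * y) := fun v y => by
    rw [A v (v * y), imul, rip', A v y, Rinv y]
    group
  have P : ∀ x q, R (x * (x * (x * q))) = R (x * q) * (R q)⁻¹ * R (x * (x * q)) := fun x q => by
    rw [A x (x * q), imul, rip', Rinv]
  have hR1 : R 1 = 1 := by
    ext z
    exact mul_one' z
  -- power alternativity
  let p : M → ℕ → M := fun x n => Nat.rec 1 (fun _ q => x * q) n
  have p0 : ∀ x, p x 0 = 1 := fun _ => rfl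
  have ps : ∀ x n, p x (n + 1) = x * p x n := fun _ _ => rfl
  have R2 : ∀ x, R (x * x) = R x * R x := fun x => by
    have h := W 1 x
    simpa only [one_mul', mul_one', hR1, mul_one] using h
  have pow : ∀ x n, R (p x n) = R x ^ n ∧ R (p x (n + 1)) = R x ^ (n + 1) ∧
      R (p x (n + 2)) = R x ^ (n + 2) := fun x n => by
    induction n with
    | zero =>
      refine ⟨by rw [p0, hR1, pow_zero], by rw [ps, p0, mul_one', zero_add, pow_one], ?_⟩
      have h2 : p x (0 + 2) = x * (x * 1) := rfl
      rw [h2, mul_one', R2, zero_add, pow_two]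
    | succ n ih =>
      obtain ⟨h0, h1, h2⟩ := ih
      refine ⟨h1, h2, ?_⟩
      have h : R (p x (n + 2 + 1)) = R (p x (n + 1)) * (R (p x n))⁻¹ * R (p x (n + 2)) :=
        P x (p x n)
      rw [h0, h1, h2] at h
      rw [show n + 1 + 2 = n + 2 + 1 from rfl, h]
      group
  have Rinj : ∀ x y, R x = R y → x = y := fun x y h => by
    have := congrArg (fun f : Equiv.Perm M => f 1) h
    simpa only [Rap, one_mul'] using this
  have oddord : ∀ x, Odd (orderOf (R x)) := fun x => by
    by_contra hne
    rw [Nat.not_odd_iff_even] at hne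
    obtain ⟨k, hk⟩ := hne
    have hpos : 0 < orderOf (R x) := orderOf_pos _
    have hb : (R x ^ k) ^ (2 ^ 1) = 1 := by
      rw [← pow_mul, show k * 2 ^ 1 = orderOf (R x) by omega, pow_orderOf_eq_one]
    have hb1 : R x ^ k ≠ 1 := pow_ne_one_of_lt_orderOf (by omega) (by omega)
    have : Fact (Nat.Prime 2) := ⟨Nat.prime_two⟩
    have hc := Equiv.Perm.card_fixedPoints_modEq (f := ((R x ^ k : Equiv.Perm M) : M → M))
      (p := 2) (n := 1) (by
        funext z
        have hz : (R x ^ k) ((R x ^ k) z) = z := by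
          have := congrArg (fun f : Equiv.Perm M => f z) hb
          simpa [pow_two] using this
        exact hz)
    have : IsEmpty (Function.fixedPoints ((R x ^ k : Equiv.Perm M) : M → M)) := ⟨by
      rintro ⟨z, hz⟩
      apply hb1
      rw [← (pow x k).1] at hz ⊢
      have hz' : z * p x k = z * 1 := by
        rw [mul_one']
        exact hz
      rw [lc _ _ _ hz', hR1]⟩
    rw [Fintype.card_eq_zero (α := Function.fixedPoints _)] at hc
    have := Nat.odd_iff.mp hodd
    unfold Nat.ModEq at hc
    omega
  have sq : ∀ x, ∃ v : M, v * v = x := fun x => by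
    obtain ⟨k, hk⟩ := oddord x
    refine ⟨p x (k + 1), Rinj _ _ ?_⟩
    rw [R2, (pow x (k + 1)).1, ← pow_add, show k + 1 + (k + 1) = orderOf (R x) + 1 by omega,
      pow_succ, pow_orderOf_eq_one, one_mul]
  intro z t w
  obtain ⟨v, hv⟩ := sq (t * w)
  have h := C v (v * i w)
  have ht : v * (v * i w) = t := by rw [← lalt, hv, rip]
  rw [imul, ii, rip', ht, ← lalt, hv, ← hflex] at h
  have := congrArg (fun f : Equiv.Perm M => f z) h
  exact this.symm
end

section
/- In an ARIF loop, if elements p, a, q satisfy p·(aq) = (pa)·q, (pa)·(a⁻¹q) = pq, and (pa⁻¹)·(aq) = pq, then (p·aᵐ)·(aⁿ·q) = (p·a^{m+k})·(a^{n−k}·q) for all integers m, n, k. -/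
/-- An inverse property (IP) loop. -/
class IPLoop (M : Type*) extends Loop M, Inv M where
  inv_mul_cancel_left : ∀ x y : M, x⁻¹ * (x * y) = y
  mul_inv_cancel_right : ∀ x y : M, (y * x) * x⁻¹ = y

/-- Left translation `L(x) : y ↦ x * y` as a permutation. -/
def Loop.Lperm {M : Type*} [Loop M] (x : M) : Equiv.Perm M :=
  ⟨fun y => x * y, fun y => Loop.ld x y, Loop.ld_mul x, Loop.mul_ld x⟩

/-- Right translation `R(x) : y ↦ y * x` as a permutation. -/
def Loop.Rperm {M : Type*} [Loop M] (x : M) : Equiv.Perm M :=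
  ⟨fun y => y * x, fun y => Loop.rd y x, fun y => Loop.mul_rd x y, fun y => Loop.rd_mul x y⟩

/-- Integer powers: `xⁿ = 1 · L(x)ⁿ`. -/
def Loop.pow {M : Type*} [Loop M] (x : M) (n : ℤ) : M := (Loop.Lperm x ^ n) 1

namespace ArifAux

variable {M : Type*} [IPLoop M]

lemma cl (x y : M) : x⁻¹ * (x * y) = y := IPLoop.inv_mul_cancel_left x y
lemma cr (x y : M) : (y * x) * x⁻¹ = y := IPLoop.mul_inv_cancel_right x y
lemma omul (x : M) : 1 * x = x := Loop.one_mul x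
lemma mulo (x : M) : x * 1 = x := Loop.mul_one x
lemma lcan {x y z : M} (h : x * y = x * z) : y = z := by rw [← cl x y, h, cl]
lemma rcan {x y z : M} (h : y * x = z * x) : y = z := by rw [← cr x y, h, cr]
lemma inv_l (x : M) : x⁻¹ * x = 1 := by have := cl x 1; rwa [mulo] at this
lemma inv_r (x : M) : x * x⁻¹ = 1 := by have := cr x 1; rwa [omul] at this
lemma ii (x : M) : x⁻¹⁻¹ = x := by
  apply lcan (x := x⁻¹); rw [inv_r, inv_l]
lemma cl' (x y : M) : x * (x⁻¹ * y) = y := by have := cl x⁻¹ y; rwa [ii] at this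
lemma cr' (x y : M) : (y * x⁻¹) * x = y := by have := cr x⁻¹ y; rwa [ii] at this
lemma minv (x y : M) : (x * y)⁻¹ = y⁻¹ * x⁻¹ := by
  apply rcan (x := x * y); rw [inv_l]
  have h1 : (x * y) * y⁻¹ = x := cr y x
  have h2 : (x * y)⁻¹ * x = y⁻¹ := by
    have h4 := cl (x * y) y⁻¹
    rwa [h1] at h4
  have h3 : (x * y)⁻¹ = y⁻¹ * x⁻¹ := by rw [← h2, cr]
  rw [← h3, inv_l]

/-- the hypotheses of an ARIF loop -/
def Arif (M : Type*) [IPLoop M] : Prop :=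
  (∀ x y : M, x * (y * x) = (x * y) * x) ∧
  (∀ x y z : M, (z * x) * (y * (x * y)) = (z * (x * (y * x))) * y) ∧
  (∀ x y z : M, (y * (x * y)) * (x * z) = y * ((x * (y * x)) * z))

lemma ralt (h : Arif M) (z x : M) : (z * x) * x = z * (x * x) := by
  have := h.2.1 x 1 z
  simpa [omul, mulo] using this
lemma lalt (h : Arif M) (z x : M) : x * (x * z) = (x * x) * z := by
  have := h.2.2 x 1 z
  simpa [omul, mulo] using this

lemma ruleA (h : Arif M) (P g H : M) (e : P * H = (P * g) * (g⁻¹ * H)) :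
    P * (g * (g * H)) = (P * g) * (g * H) := by
  have w := h.2.1 H⁻¹ (g * H) (P * H)
  rw [h.1 (g * H) H⁻¹, cr, cr] at w
  have e2 : (P * H) * (H⁻¹ * g) = P * g := by
    have : H⁻¹ * g = (g⁻¹ * H)⁻¹ := by rw [minv, ii]
    rw [this, e, cr]
  rw [e2] at w
  exact w

lemma ruleB (h : Arif M) (P g H : M) (e : P * H = ((P * g) * g) * (g⁻¹ * (g⁻¹ * H))) :
    P * (g * H) = ((P * g) * g) * (g⁻¹ * H) := by
  have w := h.2.1 H (H⁻¹ * g) P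
  rw [h.1 H (H⁻¹ * g), cl'] at w
  have e2 : (P * H) * ((H⁻¹ * g) * g) = (P * g) * g := by
    have : (H⁻¹ * g) * g = (g⁻¹ * (g⁻¹ * H))⁻¹ := by rw [minv, minv, ii]
    rw [this, e, cr]
  rw [e2] at w
  have : g⁻¹ * H = (H⁻¹ * g)⁻¹ := by rw [minv, ii]
  rw [this, w, cr]

lemma ruleA' (h : Arif M) (P g H : M) (e : P * H = (P * g⁻¹) * (g * H)) :
    ((P * g) * g) * H = (P * g) * (g * H) := by
  have w := ruleA h H⁻¹ g⁻¹ P⁻¹ (by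
    have := congrArg (·⁻¹) e
    simpa only [minv, ii] using this)
  have := congrArg (·⁻¹) w
  simpa only [minv, ii] using this

lemma step2 (X : ℤ → Prop) (n₀ : ℤ) (h0 : X n₀) (hs : ∀ n, X n → X (n + 2))
    (hp : ∀ n, X n → X (n - 2)) (k : ℤ) : X (n₀ + 2 * k) := by
  induction k using Int.induction_on with
  | zero => simpa using h0
  | succ i ih => have := hs _ ih; convert this using 1; ring
  | pred i ih => have := hp _ ih; convert this using 1; ring

lemma parity (X : ℤ → Prop) (n₀ : ℤ) (h0 : X n₀) (h1 : X (n₀ + 1)) (hs : ∀ n, X n → X (n + 2))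
    (hp : ∀ n, X n → X (n - 2)) (n : ℤ) : X n := by
  rcases Int.even_or_odd' (n - n₀) with ⟨k, hk | hk⟩
  · have := step2 X n₀ h0 hs hp k; convert this using 1; omega
  · have := step2 X _ h1 hs hp k; convert this using 1; omega

lemma chain (h : Arif M) (a : M) (u v : ℤ → M) (hu : ∀ m, u (m + 1) = u m * a)
    (hv : ∀ n, v (n + 1) = a * v n) (h1 : u 0 * v 1 = u 1 * v 0) (h2 : u 1 * v (-1) = u 0 * v 0)
    (h3 : u (-1) * v 1 = u 0 * v 0) (m n : ℤ) : u m * v n = u (m + 1) * v (n - 1) := by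
  have hu' : ∀ m, u m = u (m - 1) * a := fun m => by rw [← hu]; congr 1; ring
  have hv' : ∀ n, v n = a * v (n - 1) := fun n => by rw [← hv]; congr 1; ring
  have hui : ∀ m, u m * a⁻¹ = u (m - 1) := fun m => by rw [hu' m, cr]
  have hvi : ∀ n, a⁻¹ * v n = v (n - 1) := fun n => by rw [hv' n, cl]
  have A : ∀ m n, u m * v n = u (m + 1) * v (n - 1) →
      u m * v (n + 2) = u (m + 1) * v (n + 2 - 1) := by
    intro m n e
    have := ruleA h (u m) a (v n) (by rw [← hu, hvi]; exact e)
    rw [← hv, ← hv, ← hu] at this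
    convert this using 3 <;> ring
  have Ai : ∀ m n, u m * v n = u (m + 1) * v (n - 1) →
      u m * v (n - 2) = u (m + 1) * v (n - 2 - 1) := by
    intro m n e
    have := ruleA h (u (m + 1)) a⁻¹ (v (n - 1)) (by
      rw [ii, hui, ← hv, ← e]; congr 2 <;> ring)
    rw [hvi, hvi, hui] at this
    convert this.symm using 3 <;> ring
  have A' : ∀ n m, u m * v n = u (m + 1) * v (n - 1) →
      u (m + 2) * v n = u (m + 2 + 1) * v (n - 1) := by
    intro n m e
    have := ruleA' h (u (m + 1)) a (v (n - 1)) (by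
      rw [hui, ← hv, ← e]; congr 2 <;> ring)
    rw [← hu, ← hu, ← hv] at this
    convert this.symm using 3 <;> ring
  have Ai' : ∀ n m, u m * v n = u (m + 1) * v (n - 1) →
      u (m - 2) * v n = u (m - 2 + 1) * v (n - 1) := by
    intro n m e
    have := ruleA' h (u m) a⁻¹ (v n) (by
      rw [ii, ← hu, hvi]; exact e)
    rw [hui, hui, hvi] at this
    convert this using 3 <;> ring
  have B : ∀ m n, u m * v n = u (m + 2) * v (n - 2) →
      u m * v (n + 1) = u (m + 2) * v (n + 1 - 2) := by
    intro m n e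
    have := ruleB h (u m) a (v n) (by
      rw [← hu, ← hu, hvi, hvi, e]; congr 2 <;> ring)
    rw [← hu, ← hu, hvi, ← hv] at this
    convert this using 3 <;> ring
  have Bi : ∀ m n, u m * v n = u (m + 2) * v (n - 2) →
      u m * v (n - 1) = u (m + 2) * v (n - 1 - 2) := by
    intro m n e
    have := ruleB h (u (m + 2)) a⁻¹ (v (n - 2)) (by
      rw [ii, hui, hui, ← hv, ← hv, ← e]; congr 2 <;> ring)
    rw [hui, hui, hvi, ii, ← hv] at this
    convert this.symm using 3 <;> ring
  have E0 : ∀ n, u 0 * v n = u (0 + 1) * v (n - 1) :=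
    parity _ 0 (by simpa using h2.symm) (by simpa using h1) (A 0) (Ai 0)
  have E2 : ∀ n, u (-1) * v n = u (-1 + 2) * v (n - 2) := by
    have h12 : u (-1) * v 1 = u (-1 + 2) * v (1 - 2) := by
      rw [h3, ← h2]; norm_num
    have h10 : u (-1) * v (1 + 1) = u (-1 + 2) * v (1 + 1 - 2) := B _ _ h12
    exact parity _ 1 h12 h10 (fun n e => by
        have := B _ _ (B _ _ e); convert this using 3 <;> ring)
      (fun n e => by
        have := Bi _ _ (Bi _ _ e); convert this using 3 <;> ring)
  have E1 : ∀ n, u (-1) * v n = u (-1 + 1) * v (n - 1) := by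
    intro n
    rw [E2 n]
    have := E0 (n - 1)
    norm_num at this ⊢
    rw [this]; congr 2; ring
  exact parity (fun m => u m * v n = u (m + 1) * v (n - 1)) (-1) (E1 n) (E0 n) (A' n) (Ai' n) m

lemma Linv (x : M) : Loop.Lperm x⁻¹ = (Loop.Lperm x)⁻¹ := by
  rw [eq_inv_iff_mul_eq_one]; ext y; exact cl x y
lemma Rinv (x : M) : Loop.Rperm x⁻¹ = (Loop.Rperm x)⁻¹ := by
  rw [eq_inv_iff_mul_eq_one]; ext y; exact cr x y
lemma Lone : Loop.Lperm (1 : M) = 1 := by ext y; exact omul y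
lemma Rone : Loop.Rperm (1 : M) = 1 := by ext y; exact mulo y

lemma triple (X : ℤ → Prop) (h0 : X 0) (h1 : X 1) (hn : ∀ k, X k → X (-k))
    (hs : ∀ n, X n → X (n - 1) → X (2 - n) → X (n + 1)) (k : ℤ) : X k := by
  have key : ∀ n : ℕ, X ((n : ℤ) - 1) ∧ X n ∧ X ((n : ℤ) + 1) := by
    intro n
    induction n with
    | zero => exact ⟨by simpa using hn _ h1, by simpa using h0, by simpa using h1⟩
    | succ n ih =>
      obtain ⟨a, b, c⟩ := ih
      push_cast
      refine ⟨by simpa using b, c, hs _ c (by simpa using b) ?_⟩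
      have := hn _ a
      convert this using 1; ring
  rcases Int.eq_nat_or_neg k with ⟨n, rfl | rfl⟩
  · exact (key n).2.1
  · exact hn _ (key n).2.1

lemma Lapp (x y : M) : x * y = Loop.Lperm x y := rfl
lemma Rapp (x y : M) : x * y = Loop.Rperm y x := rfl

lemma Lpow (h : Arif M) (a : M) (k : ℤ) : Loop.Lperm (Loop.pow a k) = Loop.Lperm a ^ k := by
  have neg : ∀ k : ℤ, Loop.Lperm (Loop.pow a k) = Loop.Lperm a ^ k →
      Loop.pow a (-k) = (Loop.pow a k)⁻¹ := by
    intro k e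
    rw [← mulo (Loop.pow a k)⁻¹, Lapp, Linv, e, ← zpow_neg]; rfl
  have hadd : ∀ k l : ℤ, Loop.Lperm (Loop.pow a k) = Loop.Lperm a ^ k →
      Loop.pow a k * Loop.pow a l = Loop.pow a (k + l) := by
    intro k l e
    rw [Lapp, e, Loop.pow, Loop.pow, zpow_add]; rfl
  have hneg : ∀ k : ℤ, Loop.Lperm (Loop.pow a k) = Loop.Lperm a ^ k →
      Loop.Lperm (Loop.pow a (-k)) = Loop.Lperm a ^ (-k) := by
    intro k e
    rw [neg k e, Linv, e, zpow_neg]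
  refine triple (fun k => Loop.Lperm (Loop.pow a k) = Loop.Lperm a ^ k) ?_ ?_ hneg ?_ k
  · simp [Loop.pow, Lone]
  · simp only [Loop.pow, zpow_one]
    rw [← Lapp, mulo]
  · intro n e1 e2 e3
    have e2' := hneg _ e2
    have w : Loop.Lperm (Loop.pow a n * (Loop.pow a (-(n - 1)) * Loop.pow a n))
        * Loop.Lperm (Loop.pow a (-(n - 1))) = Loop.Lperm (Loop.pow a n) *
        Loop.Lperm (Loop.pow a (-(n - 1)) * (Loop.pow a n * Loop.pow a (-(n - 1)))) := by
      ext z; exact h.2.2 _ _ z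
    rw [hadd _ _ e2', hadd _ _ e1, hadd _ _ e1, hadd _ _ e2',
      show n + (-(n - 1) + n) = n + 1 by ring, show -(n - 1) + (n + -(n - 1)) = 2 - n by ring,
      e1, e2', e3, ← eq_mul_inv_iff_mul_eq, ← zpow_neg, ← zpow_add, ← zpow_add] at w
    show Loop.Lperm (Loop.pow a (n + 1)) = _
    rw [w]; congr 1; ring

lemma pow_add' (h : Arif M) (a : M) (k l : ℤ) :
    Loop.pow a k * Loop.pow a l = Loop.pow a (k + l) := by
  rw [Lapp, Lpow h, Loop.pow, Loop.pow, zpow_add]; rfl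

lemma Rpow (h : Arif M) (a : M) (k : ℤ) : Loop.Rperm (Loop.pow a k) = Loop.Rperm a ^ k := by
  refine triple (fun k => Loop.Rperm (Loop.pow a k) = Loop.Rperm a ^ k) ?_ ?_ ?_ ?_ k
  · simp [Loop.pow, Rone]
  · simp only [Loop.pow, zpow_one]
    rw [← Lapp, mulo]
  · intro k e
    have : Loop.pow a (-k) = (Loop.pow a k)⁻¹ := by
      apply lcan (x := Loop.pow a k)
      rw [pow_add' h, inv_r]; simp [Loop.pow]
    show Loop.Rperm (Loop.pow a (-k)) = _
    rw [this, Rinv, e, zpow_neg]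
  · intro n e1 e2 e3
    have e2' : Loop.Rperm (Loop.pow a (-(n - 1))) = Loop.Rperm a ^ (-(n - 1)) := by
      have : Loop.pow a (-(n - 1)) = (Loop.pow a (n - 1))⁻¹ := by
        apply lcan (x := Loop.pow a (n - 1))
        rw [pow_add' h, inv_r]; simp [Loop.pow]
      rw [this, Rinv, e2, zpow_neg]
    have w : Loop.Rperm (Loop.pow a n * (Loop.pow a (-(n - 1)) * Loop.pow a n))
        * Loop.Rperm (Loop.pow a (-(n - 1))) = Loop.Rperm (Loop.pow a n) *
        Loop.Rperm (Loop.pow a (-(n - 1)) * (Loop.pow a n * Loop.pow a (-(n - 1)))) := by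
      ext z; exact h.2.1 _ _ z
    simp only [pow_add' h] at w
    rw [show n + (-(n - 1) + n) = n + 1 by ring, show -(n - 1) + (n + -(n - 1)) = 2 - n by ring,
      e1, e2', e3, ← eq_mul_inv_iff_mul_eq, ← zpow_neg, ← zpow_add, ← zpow_add] at w
    show Loop.Rperm (Loop.pow a (n + 1)) = _
    rw [w]; congr 1; ring

end ArifAux

/-- In an ARIF loop, if `p·(aq) = (pa)·q`, `(pa)·(a⁻¹q) = pq` and `(pa⁻¹)·(aq) = pq`,
then `(p·aᵐ)·(aⁿ·q) = (p·a^{m+k})·(a^{n-k}·q)` for all integers `m, n, k`. -/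
theorem arif_powers_shift {M : Type*} [IPLoop M]
    (hflex : ∀ x y : M, x * (y * x) = (x * y) * x)
    (hW1 : ∀ x y z : M, (z * x) * (y * (x * y)) = (z * (x * (y * x))) * y)
    (hW2 : ∀ x y z : M, (y * (x * y)) * (x * z) = y * ((x * (y * x)) * z))
    (p a q : M)
    (h1 : p * (a * q) = (p * a) * q)
    (h2 : (p * a) * (a⁻¹ * q) = p * q)
    (h3 : (p * a⁻¹) * (a * q) = p * q) :
    ∀ m n k : ℤ,
      (p * Loop.pow a m) * (Loop.pow a n * q) =
        (p * Loop.pow a (m + k)) * (Loop.pow a (n - k) * q) := by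
  have h : ArifAux.Arif M := ⟨hflex, hW1, hW2⟩
  have p0 : Loop.pow a 0 = 1 := by simp [Loop.pow]
  have p1 : Loop.pow a 1 = a := by
    simp only [Loop.pow, zpow_one]
    rw [← ArifAux.Lapp, ArifAux.mulo]
  have pn : Loop.pow a (-1) = a⁻¹ := by
    simp only [Loop.pow, zpow_neg, zpow_one]
    rw [← ArifAux.Linv, ← ArifAux.Lapp, ArifAux.mulo]
  have key := ArifAux.chain h a (fun m => p * Loop.pow a m) (fun n => Loop.pow a n * q)
    (by
      intro m
      show p * Loop.pow a (m + 1) = (p * Loop.pow a m) * a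
      rw [ArifAux.Rapp p, ArifAux.Rapp p, ArifAux.Rpow h, ArifAux.Rpow h, add_comm, zpow_add,
        zpow_one]
      rfl)
    (by
      intro n
      show Loop.pow a (n + 1) * q = a * (Loop.pow a n * q)
      rw [ArifAux.Lapp _ q, ArifAux.Lapp _ q, ArifAux.Lpow h, ArifAux.Lpow h, add_comm, zpow_add,
        zpow_one]
      rfl)
    (by simpa only [p0, p1, pn, ArifAux.omul, ArifAux.mulo] using h1)
    (by simpa only [p0, p1, pn, ArifAux.omul, ArifAux.mulo] using h2)
    (by simpa only [p0, p1, pn, ArifAux.omul, ArifAux.mulo] using h3)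
  intro m n k
  induction k using Int.induction_on with
  | zero => simp
  | succ i ih =>
    rw [ih, key]
    congr 3 <;> ring
  | pred i ih =>
    rw [ih, key (m + (-(i : ℤ) - 1))]
    congr 3 <;> ring
end

section
/- Every ARIF loop is diassociative: in any flexible loop satisfying R(x)R(yxy) = R(xyx)R(y) and L(x)L(yxy) = L(xyx)L(y), the subloop generated by any two elements is a group. -/
/-- Membership in the subloop generated by `a` and `b`. -/
inductive Loop.genBy {M : Type*} [Loop M] (a b : M) : M → Prop
  | one : Loop.genBy a b 1
  | fst : Loop.genBy a b a
  | snd : Loop.genBy a b b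
  | mul {x y : M} : Loop.genBy a b x → Loop.genBy a b y → Loop.genBy a b (x * y)
  | ld {x y : M} : Loop.genBy a b x → Loop.genBy a b y → Loop.genBy a b (Loop.ld x y)
  | rd {x y : M} : Loop.genBy a b x → Loop.genBy a b y → Loop.genBy a b (Loop.rd x y)

namespace ArifProof

/-- ARIF loops, bundled. -/
class ARIF (M : Type*) extends Loop M where
  flex : ∀ x y : M, x * (y * x) = (x * y) * x
  W1 : ∀ x y z : M, (z * x) * (y * (x * y)) = (z * (x * (y * x))) * y
  W2 : ∀ x y z : M, (y * (x * y)) * (x * z) = y * ((x * (y * x)) * z)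

section basics
variable {M : Type*} [ARIF M]

theorem one_mul' (x : M) : 1 * x = x := Loop.one_mul x
theorem mul_one' (x : M) : x * 1 = x := Loop.mul_one x
theorem mul_cancel_left' {x y z : M} : x * y = x * z ↔ y = z :=
  ⟨fun h => by rw [← Loop.ld_mul x y, h, Loop.ld_mul], fun h => by rw [h]⟩
theorem mul_cancel_right' {x y z : M} : y * x = z * x ↔ y = z :=
  ⟨fun h => by rw [← Loop.mul_rd x y, h, Loop.mul_rd], fun h => by rw [h]⟩

instance : Inv M := ⟨fun x => Loop.ld x 1⟩

theorem mul_inv' (x : M) : x * x⁻¹ = 1 := Loop.mul_ld x 1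
theorem inv_mul' (x : M) : x⁻¹ * x = 1 := by
  have h := ARIF.flex x x⁻¹
  rw [mul_inv', one_mul'] at h
  exact mul_cancel_left'.1 (h.trans (mul_one' x).symm)

theorem lip (x u : M) : x⁻¹ * (x * u) = u := by
  have h := ARIF.W1 x (Loop.rd u x) x⁻¹
  rw [inv_mul', one_mul', Loop.rd_mul] at h
  have h2 : ∀ y : M, y * x = u → y * (x * y) = (x⁻¹ * (x * u)) * y := by
    intro y hy
    have h := ARIF.W1 x y x⁻¹
    rwa [inv_mul', one_mul', hy] at h
  have h3 := h2 _ (Loop.rd_mul x u)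
  rw [ARIF.flex, Loop.rd_mul] at h3
  exact (mul_cancel_right'.1 h3).symm

theorem rip (x u : M) : (u * x) * x⁻¹ = u := by
  have h2 : ∀ y : M, x * y = u → y * (x * y) = y * (((u * x)) * x⁻¹) := by
    intro y hy
    have h := ARIF.W2 x y x⁻¹
    rw [mul_inv', mul_one', ARIF.flex x y, hy] at h
    rw [hy, h]
  have h3 := h2 _ (Loop.mul_ld x u)
  rw [Loop.mul_ld] at h3
  exact (mul_cancel_left'.1 h3).symm

theorem inv_unique {x y : M} (h : x * y = 1) : y = x⁻¹ := by
  rw [← mul_cancel_left' (x := x), h, mul_inv']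
theorem inv_inv' (x : M) : x⁻¹⁻¹ = x := (inv_unique (inv_mul' x)).symm
theorem lip2 (x u : M) : x * (x⁻¹ * u) = u := by
  have := lip x⁻¹ u; rwa [inv_inv'] at this
theorem rip2 (x u : M) : (u * x⁻¹) * x = u := by
  have := rip x⁻¹ u; rwa [inv_inv'] at this
theorem mul_inv_rev' (x y : M) : (x * y)⁻¹ = y⁻¹ * x⁻¹ := by
  have h1 : x⁻¹ = y * (x * y)⁻¹ := by
    have h := rip (x * y) (x⁻¹)
    rw [lip] at h
    exact h.symm
  rw [h1, lip]
theorem inv_one' : (1 : M)⁻¹ = 1 := (inv_unique (one_mul' 1)).symm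
theorem inv_inj' {x y : M} : x⁻¹ = y⁻¹ ↔ x = y :=
  ⟨fun h => by rw [← inv_inv' x, h, inv_inv'], fun h => by rw [h]⟩

theorem ralt (x z : M) : (z * x) * x = z * (x * x) := by
  have := ARIF.W1 x 1 z
  simpa [one_mul', mul_one'] using this
theorem lalt (x z : M) : x * (x * z) = (x * x) * z := by
  have := ARIF.W2 x 1 z
  simpa [one_mul', mul_one'] using this

/-- left translation -/
def Lp (x : M) : Equiv.Perm M where
  toFun u := x * u
  invFun u := x⁻¹ * u
  left_inv u := lip x u
  right_inv u := lip2 x u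
/-- right translation -/
def Rp (x : M) : Equiv.Perm M where
  toFun u := u * x
  invFun u := u * x⁻¹
  left_inv u := rip x u
  right_inv u := rip2 x u

@[simp] theorem Lp_apply (x u : M) : Lp x u = x * u := rfl
@[simp] theorem Rp_apply (x u : M) : Rp x u = u * x := rfl
theorem Lp_inv (x : M) : Lp x⁻¹ = (Lp x)⁻¹ := by
  ext u; rfl
theorem Rp_inv (x : M) : Rp x⁻¹ = (Rp x)⁻¹ := by
  ext u; rfl

/-- powers -/
def pw (x : M) (i : ℤ) : M := (Lp x ^ i) 1

theorem pw_zero (x : M) : pw x 0 = 1 := rfl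
theorem pw_one (x : M) : pw x 1 = x := by simp [pw, mul_one']
theorem pw_neg_one (x : M) : pw x (-1) = x⁻¹ := by
  simp only [pw, zpow_neg, zpow_one, ← Lp_inv, Lp_apply, mul_one']

theorem Lp_pw_add {x : M} {i : ℤ} (j : ℤ) (h : Lp (pw x i) = Lp x ^ i) :
    pw x i * pw x j = pw x (i + j) := by
  rw [← Lp_apply, h]; simp [pw, zpow_add]

theorem Lp_pw_neg {x : M} {i : ℤ} (h : Lp (pw x i) = Lp x ^ i) :
    pw x (-i) = (pw x i)⁻¹ := by
  apply inv_unique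
  rw [Lp_pw_add _ h]; simp [pw_zero]

theorem nat_step (P : ℤ → Prop) (h0 : P 0) (h1 : P 1) (hd : ∀ i, P i → P (i + i))
    (ho : ∀ m, P m → P (m - 2) → P (2 * m - 1)) (hn : ∀ i, P i → P (-i)) : ∀ i, P i := by
  have hnat : ∀ n : ℕ, P n := by
    intro n
    induction n using Nat.strong_induction_on with
    | _ n ih =>
      rcases Nat.even_or_odd' n with ⟨m, rfl | rfl⟩
      · rcases Nat.eq_zero_or_pos m with rfl | hm
        · simpa using h0
        · have := hd _ (ih m (by omega))
          convert this using 1; push_cast; ring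
      · rcases Nat.eq_zero_or_pos m with rfl | hm
        · simpa using h1
        · have := ho (m + 1 : ℕ) (ih _ (by omega)) (by
            have := ih (m - 1) (by omega)
            convert this using 1; push_cast [hm]; ring)
          convert this using 1; push_cast; ring
  intro i
  rcases Int.eq_nat_or_neg i with ⟨n, rfl | rfl⟩
  · exact hnat n
  · exact hn _ (hnat n)

theorem Lp_pw (x : M) : ∀ i : ℤ, Lp (pw x i) = Lp x ^ i := by
  have hm1 : Lp (pw x (-1)) = Lp x ^ (-1 : ℤ) := by
    rw [pw_neg_one, Lp_inv]; simp
  apply nat_step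
  · ext u; simp [pw_zero, one_mul']
  · simp [pw_one]
  · intro i h
    rw [← Lp_pw_add _ h, zpow_add, ← h]
    ext u; simp [lalt]
  · intro m h h2
    have h3 := ARIF.W2 (pw x m) (pw x (-1))
    rw [Lp_pw_add _ h, Lp_pw_add _ hm1, Lp_pw_add _ hm1, Lp_pw_add _ h] at h3
    have h4 : Lp (pw x (m - 2)) * Lp (pw x m) = Lp (pw x (-1)) * Lp (pw x (2 * m - 1)) := by
      ext u
      have := h3 u
      simp only [Equiv.Perm.mul_apply, Lp_apply]
      convert this using 3 <;> ring_nf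
    rw [h2, h, hm1, ← zpow_add] at h4
    rw [← mul_right_inj (Lp x ^ (-1 : ℤ)), ← h4, ← zpow_add]; congr 1; ring
  · intro i h
    rw [Lp_pw_neg h, Lp_inv, h, zpow_neg]

theorem pw_add (x : M) (i j : ℤ) : pw x i * pw x j = pw x (i + j) := Lp_pw_add _ (Lp_pw x i)
theorem pw_neg (x : M) (i : ℤ) : pw x (-i) = (pw x i)⁻¹ := Lp_pw_neg (Lp_pw x i)

theorem Rp_pw (x : M) : ∀ i : ℤ, Rp (pw x i) = Rp x ^ i := by
  have hm1 : Rp (pw x (-1)) = Rp x ^ (-1 : ℤ) := by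
    rw [pw_neg_one, Rp_inv]; simp
  apply nat_step
  · ext u; simp [pw_zero, mul_one']
  · simp [pw_one]
  · intro i h
    rw [← pw_add, zpow_add, ← h]
    ext u; simp [ralt]
  · intro m h h2
    have h3 := ARIF.W1 (pw x m) (pw x (-1))
    simp only [pw_add] at h3
    have h4 : Rp (pw x (m - 2)) * Rp (pw x m) = Rp (pw x (-1)) * Rp (pw x (2 * m - 1)) := by
      ext u
      have := h3 u
      simp only [Equiv.Perm.mul_apply, Rp_apply]
      convert this using 3 <;> ring_nf
    rw [h2, h, hm1, ← zpow_add] at h4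
    rw [← mul_right_inj (Rp x ^ (-1 : ℤ)), ← h4, ← zpow_add]; congr 1; ring
  · intro i h
    rw [pw_neg, Rp_inv, h, zpow_neg]

theorem pw_mul_pw_mul (x u : M) (i j : ℤ) : pw x i * (pw x j * u) = pw x (i + j) * u := by
  rw [← Lp_apply, ← Lp_apply, ← Lp_apply, Lp_pw, Lp_pw, Lp_pw, zpow_add]; rfl

theorem mul_pw_mul_pw (x u : M) (i j : ℤ) : (u * pw x i) * pw x j = u * pw x (i + j) := by
  rw [← Rp_apply, ← Rp_apply, ← Rp_apply, Rp_pw, Rp_pw, Rp_pw, add_comm, zpow_add]; rfl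

theorem pw_flex (x u : M) (i j : ℤ) : pw x i * (u * pw x j) = (pw x i * u) * pw x j := by
  have h : Commute (Lp x) (Rp x) := by
    ext v; simp [ARIF.flex]
  have h2 := (h.zpow_zpow i j)
  rw [← Lp_pw, ← Rp_pw] at h2
  exact congrArg (fun f : Equiv.Perm M => f u) h2.eq

/-- Quad rule A, value form. -/
theorem quadA (X Y U V : M) :
    U * X⁻¹ = V * (X * (Y * X))⁻¹ ↔ U * (Y * (X * Y)) = V * Y := by
  have h := ARIF.W1 X Y (U * X⁻¹)
  rw [rip2] at h
  rw [h, mul_cancel_right']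
  constructor
  · intro e; rw [e, rip2]
  · intro e; rw [← e, rip]

/-- Quad rule B, value form. -/
theorem quadB (X Y O P : M) :
    O * X = P * (Y * (X * Y))⁻¹ ↔ O * (X * (Y * X)) = P * Y⁻¹ := by
  have h := ARIF.W1 X Y O
  constructor
  · intro e; rw [e, rip2] at h; rw [h, rip]
  · intro e; rw [e, rip2] at h; rw [← h, rip]

end basics

section freegrp

/-- The free group on two letters as a free product of two infinite cyclic groups. -/
abbrev F : Type := Monoid.CoprodI (fun _ : Bool => Multiplicative ℤ)

/-- generators -/
def g (c : Bool) : F := Monoid.CoprodI.of (M := fun _ : Bool => Multiplicative ℤ) (i := c) (Multiplicative.ofAdd 1)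

theorem g_zpow (c : Bool) (i : ℤ) :
    g c ^ i = Monoid.CoprodI.of (M := fun _ : Bool => Multiplicative ℤ) (i := c) (Multiplicative.ofAdd i) := by
  rw [g, ← map_zpow, ← ofAdd_zsmul]; simp

/-- product of a list of syllables -/
def lp (L : List (Bool × ℤ)) : F := (L.map fun p => g p.1 ^ p.2).prod

@[simp] theorem lp_nil : lp [] = 1 := rfl
@[simp] theorem lp_cons (p : Bool × ℤ) (L) : lp (p :: L) = g p.1 ^ p.2 * lp L := by simp [lp]
@[simp] theorem lp_append (L L' : List (Bool × ℤ)) : lp (L ++ L') = lp L * lp L' := by simp [lp]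

/-- reduced lists -/
def red (L : List (Bool × ℤ)) : Prop :=
  (∀ p ∈ L, p.2 ≠ 0) ∧ L.IsChain (fun p q => p.1 ≠ q.1)

/-- syllable norm -/
def N (u : F) : ℕ := (Monoid.CoprodI.Word.equiv u).toList.length

/-- word of a reduced list -/
def toW (L : List (Bool × ℤ)) (h : red L) : Monoid.CoprodI.Word (fun _ : Bool => Multiplicative ℤ) where
  toList := L.map fun p => ⟨p.1, Multiplicative.ofAdd p.2⟩
  ne_one := by
    intro l hl
    obtain ⟨p, hp, rfl⟩ := List.mem_map.1 hl
    simpa using h.1 p hp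
  chain_ne := by
    rw [List.isChain_map]; exact h.2

theorem N_lp {L : List (Bool × ℤ)} (h : red L) : N (lp L) = L.length := by
  have : lp L = (toW L h).prod := by
    simp only [lp, Monoid.CoprodI.Word.prod, toW, List.map_map]
    congr 1
    apply List.map_congr_left
    intro p _
    simp [g_zpow]
  rw [N, this]
  have h2 : Monoid.CoprodI.Word.equiv (toW L h).prod = toW L h :=
    Monoid.CoprodI.Word.equiv.apply_symm_apply (toW L h)
  rw [h2]; simp [toW]

theorem red_nil : red [] := by simp [red]

theorem red_tail {p L} (h : red (p :: L)) : red L :=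
  ⟨fun q hq => h.1 q (List.mem_cons_of_mem _ hq), h.2.tail⟩

theorem red_cons {c i d j L} (hi : i ≠ 0) (hcd : c ≠ d) (h : red ((d, j) :: L)) :
    red ((c, i) :: (d, j) :: L) := by
  refine ⟨?_, ?_⟩
  · intro p hp
    rcases List.mem_cons.1 hp with rfl | hp
    · exact hi
    · exact h.1 p hp
  · exact List.isChain_cons_cons.2 ⟨hcd, h.2⟩

theorem red_replace {c i j L} (hi : i ≠ 0) (h : red ((c, j) :: L)) : red ((c, i) :: L) := by
  cases L with
  | nil => simp [red, hi]
  | cons q L =>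
    obtain ⟨d, k⟩ := q
    exact red_cons hi (List.isChain_cons_cons.1 h.2).1 (red_tail h)

theorem step_red (c : Bool) (i : ℤ) {L} (h : red L) :
    ∃ L', red L' ∧ lp L' = g c ^ i * lp L ∧ L'.length ≤ L.length + 1 := by
  by_cases hi : i = 0
  · exact ⟨L, h, by simp [hi], by omega⟩
  cases L with
  | nil => exact ⟨[(c, i)], by simp [red, hi], by simp, by simp⟩
  | cons q L =>
    obtain ⟨d, j⟩ := q
    by_cases hcd : c = d
    · subst hcd
      by_cases hij : i + j = 0
      · refine ⟨L, red_tail h, ?_, by simp; omega⟩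
        rw [lp_cons, ← mul_assoc, ← zpow_add, hij]; simp
      · refine ⟨(c, i + j) :: L, red_replace hij h, ?_, by simp⟩
        simp only [lp_cons]
        rw [← mul_assoc, ← zpow_add]
    · exact ⟨_, red_cons hi hcd h, by simp, by simp⟩

theorem exists_lp (u : F) : ∃ L, red L ∧ lp L = u := by
  induction u using Monoid.CoprodI.induction_left with
  | one => exact ⟨[], red_nil, rfl⟩
  | mul m x ih =>
    rename_i c
    obtain ⟨L, hL, rfl⟩ := ih
    obtain ⟨L', h1, h2, _⟩ := step_red c (Multiplicative.toAdd m) hL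
    refine ⟨L', h1, ?_⟩
    rw [h2, g_zpow]; simp

theorem N_syl_mul (c : Bool) (i : ℤ) (u : F) : N (g c ^ i * u) ≤ 1 + N u := by
  obtain ⟨L, hL, rfl⟩ := exists_lp u
  obtain ⟨L', h1, h2, h3⟩ := step_red c i hL
  rw [← h2, N_lp h1, N_lp hL]; omega

theorem N_one : N 1 = 0 := by
  have := N_lp red_nil
  simpa using this

theorem N_lp_mul_le (L : List (Bool × ℤ)) (u : F) : N (lp L * u) ≤ L.length + N u := by
  induction L with
  | nil => simp
  | cons p L ih =>
    rw [lp_cons, mul_assoc]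
    have := N_syl_mul p.1 p.2 (lp L * u)
    simp only [List.length_cons]; omega

theorem N_lp_le (L : List (Bool × ℤ)) : N (lp L) ≤ L.length := by
  have := N_lp_mul_le L 1
  simpa [N_one] using this

theorem N_mul (u v : F) : N (u * v) ≤ N u + N v := by
  obtain ⟨L, hL, rfl⟩ := exists_lp u
  rw [N_lp hL]; exact N_lp_mul_le L v

theorem N_syl (c : Bool) (i : ℤ) : N (g c ^ i) ≤ 1 := by
  have := N_syl_mul c i 1
  simpa [N_one] using this

/-- inverse list -/
def il (L : List (Bool × ℤ)) : List (Bool × ℤ) := (L.map fun p => (p.1, -p.2)).reverse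

theorem il_length (L) : (il L).length = L.length := by simp [il]
theorem lp_il (L) : lp (il L) = (lp L)⁻¹ := by
  induction L with
  | nil => simp [il]
  | cons p L ih =>
    have : il (p :: L) = il L ++ [(p.1, -p.2)] := by simp [il]
    rw [this, lp_append, ih]; simp

theorem red_il {L} (h : red L) : red (il L) := by
  refine ⟨?_, ?_⟩
  · intro p hp
    simp only [il, List.mem_reverse, List.mem_map] at hp
    obtain ⟨q, hq, rfl⟩ := hp
    simpa using h.1 q hq
  · rw [il, List.isChain_reverse, List.isChain_map]
    exact h.2.imp fun _ _ hab => Ne.symm hab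

theorem N_inv (u : F) : N u⁻¹ = N u := by
  obtain ⟨L, hL, rfl⟩ := exists_lp u
  rw [← lp_il, N_lp hL, N_lp (red_il hL), il_length]

theorem N_eq_zero {u : F} (h : N u = 0) : u = 1 := by
  obtain ⟨L, hL, rfl⟩ := exists_lp u
  rw [N_lp hL] at h
  rw [List.length_eq_zero_iff.1 h]; rfl

theorem common_start (A B : List (Bool × ℤ)) : ∃ T A1 B1, A = T ++ A1 ∧ B = T ++ B1 ∧
    (A1 = [] ∨ B1 = [] ∨ ∃ a A2 b B2, A1 = a :: A2 ∧ B1 = b :: B2 ∧ a ≠ b) := by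
  induction A generalizing B with
  | nil => exact ⟨[], [], B, rfl, rfl, Or.inl rfl⟩
  | cons a A ih =>
    cases B with
    | nil => exact ⟨[], a :: A, [], rfl, rfl, Or.inr (Or.inl rfl)⟩
    | cons b B =>
      by_cases h : a = b
      · subst h
        obtain ⟨T, A1, B1, rfl, rfl, h3⟩ := ih B
        exact ⟨a :: T, A1, B1, rfl, rfl, h3⟩
      · exact ⟨[], _, _, rfl, rfl, Or.inr (Or.inr ⟨a, A, b, B, rfl, rfl, h⟩)⟩

theorem red_append_right {A B} (h : red (A ++ B)) : red B :=
  ⟨fun p hp => h.1 p (List.mem_append_right _ hp), (List.isChain_append.1 h.2).2.1⟩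
theorem red_append_left {A B} (h : red (A ++ B)) : red A :=
  ⟨fun p hp => h.1 p (List.mem_append_left _ hp), (List.isChain_append.1 h.2).1⟩

theorem red_il_append {a A B} (hA : red (a :: A)) (hB : red B)
    (h : ∀ b ∈ B.head?, a.1 ≠ b.1) : red (il (a :: A) ++ B) := by
  refine ⟨?_, ?_⟩
  · intro p hp
    rcases List.mem_append.1 hp with hp | hp
    · exact (red_il hA).1 p hp
    · exact hB.1 p hp
  · refine List.isChain_append.2 ⟨(red_il hA).2, hB.2, ?_⟩
    intro x hx y hy
    have : (il (a :: A)).getLast? = some (a.1, -a.2) := by simp [il]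
    rw [this] at hx
    simp at hx
    subst hx
    exact h y hy

/-- structure of triangles -/
theorem triangle_struct (u v : F) : N (u * v) = N u + N v ∨ N v = N u + N (u * v) ∨
    N u = N (u * v) + N v ∨ ∃ (c : Bool) (i j : ℤ) (α β t : F),
      u = α⁻¹ * g c ^ i * t ∧ v = t⁻¹ * g c ^ j * β ∧ N u = N α + 1 + N t ∧
      N v = N t + 1 + N β ∧ N (u * v) = N α + 1 + N β := by
  obtain ⟨A, hA, hAu⟩ := exists_lp u⁻¹
  obtain ⟨B, hB, rfl⟩ := exists_lp v
  obtain ⟨T, A1, B1, rfl, rfl, h⟩ := common_start A B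
  have hu : u = (lp (T ++ A1))⁻¹ := by rw [hAu]; simp
  subst hu
  have huv : (lp (T ++ A1))⁻¹ * lp (T ++ B1) = lp (il A1 ++ B1) := by
    simp only [lp_append, lp_il]; group
  rw [huv, N_inv, N_lp hA, N_lp hB]
  rcases h with rfl | rfl | ⟨a, A2, b, B2, rfl, rfl, hab⟩
  · right; left
    have : il [] ++ B1 = B1 := rfl
    rw [this, N_lp (red_append_right hB)]; simp
  · right; right; left
    rw [List.append_nil, N_lp (red_il (red_append_right hA)), il_length]; simp; omega
  · by_cases hc : a.1 = b.1
    · right; right; right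
      obtain ⟨c, i⟩ := a
      obtain ⟨d, j⟩ := b
      simp only at hc
      subst hc
      have hij : j - i ≠ 0 := by
        intro h0; apply hab; congr 1; omega
      refine ⟨c, -i, j, lp A2, lp B2, (lp T)⁻¹, ?_, ?_, ?_, ?_, ?_⟩
      · simp only [lp_append, lp_cons]; group
      · simp only [lp_append, lp_cons]; group
      · rw [N_lp (red_tail (red_append_right hA)), N_inv, N_lp (red_append_left hA)]
        simp; omega
      · rw [N_lp (red_tail (red_append_right hB)), N_inv, N_lp (red_append_left hB)]
        simp; omega
      · have e : lp (il ((c, i) :: A2) ++ (c, j) :: B2) = lp (il ((c, i - j) :: A2) ++ B2) := by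
          simp only [lp_append, lp_cons, lp_il]; group
        have hB2 : ∀ b ∈ B2.head?, c ≠ b.1 := by
          have := (red_append_right hB).2
          rw [List.isChain_cons] at this
          exact this.1
        rw [e, N_lp (red_il_append (red_replace (by omega) (red_append_right hA))
          (red_tail (red_append_right hB)) hB2), N_lp (red_tail (red_append_right hA)),
          N_lp (red_tail (red_append_right hB))]
        simp [il]; omega
    · left
      have hT : T = [] := by
        rcases List.eq_nil_or_concat T with rfl | ⟨T', x, rfl⟩
        · rfl
        · exfalso
          have h1 := (List.isChain_append.1 hA.2).2.2 x (by simp) a (by simp)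
          have h2 := (List.isChain_append.1 hB.2).2.2 x (by simp) b (by simp)
          revert h1 h2 hc
          cases a.1 <;> cases b.1 <;> cases x.1 <;> simp
      subst hT
      rw [N_lp (red_il_append (red_append_right hA) (red_append_right hB) (by simpa using hc))]
      simp [il]; omega

end freegrp

section local_lemmas
variable {M : Type*} [ARIF M]

theorem nm {u v : F} {i j : ℕ} (h : N u ≤ i) (h' : N v ≤ j) : N (u * v) ≤ i + j :=
  (N_mul u v).trans (by omega)
theorem ni {u : F} {i : ℕ} (h : N u ≤ i) : N u⁻¹ ≤ i := by rwa [N_inv]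

/-- the defining property of the evaluation map -/
structure IsPhi (φ : F → M) : Prop where
  one : φ 1 = 1
  syl : ∃ gv : Bool → M, ∀ c i u, φ (g c ^ i * u) = pw (gv c) i * φ u

/-- all triangles of diameter at most `n` are good -/
def H (φ : F → M) (n : ℕ) : Prop :=
  ∀ u v, N u ≤ n → N v ≤ n → N (u * v) ≤ n → φ u * φ v = φ (u * v)

variable {φ : F → M}

theorem IsPhi.pow (hφ : IsPhi φ) (c : Bool) : ∃ x : M, ∀ i, φ (g c ^ i) = pw x i := by
  obtain ⟨gv, h⟩ := hφ.syl
  refine ⟨gv c, fun i => ?_⟩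
  have := h c i 1
  rwa [mul_one, hφ.one, mul_one'] at this

theorem IsPhi.syl_mul (hφ : IsPhi φ) (c : Bool) (i : ℤ) (u : F) :
    φ (g c ^ i) * φ u = φ (g c ^ i * u) := by
  obtain ⟨gv, h⟩ := hφ.syl
  have h1 := h c i 1
  rw [mul_one, hφ.one, mul_one'] at h1
  rw [h, h1]

theorem Hm {n : ℕ} (h : H φ n) {u v w : F} (e : u * v = w) (hu : N u ≤ n) (hv : N v ≤ n)
    (hw : N w ≤ n) : φ u * φ v = φ w := by
  subst e; exact h u v hu hv hw

theorem Hi {n : ℕ} (hφ : IsPhi φ) (h : H φ n) {u v : F} (e : u * v = 1) (hu : N u ≤ n) :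
    φ v = (φ u)⁻¹ := by
  apply inv_unique
  rw [← hφ.one]
  have hv : v = u⁻¹ := (inv_eq_of_mul_eq_one_right e).symm
  apply Hm h e hu
  · rw [hv]; exact ni hu
  · simp [N_one]

/-- values of the split at a position inside a syllable -/
def fv (φ : F → M) (s t : F) (c : Bool) (k m : ℤ) : M :=
  φ (s * g c ^ m) * φ (g c ^ (k - m) * t)

theorem famA (hφ : IsPhi φ) {n p q : ℕ} (h : H φ n) {s t : F} (_hs : N s ≤ p) (ht : N t ≤ q)
    (hp : 1 ≤ p) (_hq : 1 ≤ q) (hpq : p + q = n) (c : Bool) (k m j : ℤ) :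
    fv φ s t c k m = fv φ s t c k (m + j) ↔
      fv φ s t c (k + 2 * j) m = fv φ s t c (k + 2 * j) (m + j) := by
  have hl : ∀ i : ℤ, N (g c ^ i * t) ≤ n := fun i => (nm (N_syl c i) ht).trans (by omega)
  have hr : ∀ i : ℤ, N (t⁻¹ * g c ^ i) ≤ n := fun i => (nm (ni ht) (N_syl c i)).trans (by omega)
  have hc : ∀ i : ℤ, N (g c ^ i) ≤ n := fun i => (N_syl c i).trans (by omega)
  have key := quadA (φ (t⁻¹ * g c ^ (m - k))) (φ (g c ^ (k - m + j) * t)) (φ (s * g c ^ m))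
    (φ (s * g c ^ (m + j)))
  have e1 : φ (g c ^ (k - m + j) * t) * φ (t⁻¹ * g c ^ (m - k)) = φ (g c ^ j) :=
    Hm h (by group) (hl _) (hr _) (hc _)
  have e2 : φ (t⁻¹ * g c ^ (m - k)) * φ (g c ^ j) = φ (t⁻¹ * g c ^ (m - k + j)) :=
    Hm h (by group) (hr _) (hc _) (hr _)
  have e3 : φ (g c ^ j) * φ (g c ^ (k - m + j) * t) = φ (g c ^ (k + 2 * j - m) * t) :=
    Hm h (by group) (hc _) (hl _) (hl _)
  have e4 : φ (g c ^ (k - m) * t) = (φ (t⁻¹ * g c ^ (m - k)))⁻¹ :=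
    Hi hφ h (by group) (hr _)
  have e5 : φ (g c ^ (k - (m + j)) * t) = (φ (t⁻¹ * g c ^ (m - k + j)))⁻¹ :=
    Hi hφ h (by group) (hr _)
  have e6 : k + 2 * j - (m + j) = k - m + j := by ring
  rw [ARIF.flex (φ (g c ^ (k - m + j) * t)), e1, e2, e3, ← e4, ← e5] at key
  unfold fv
  rw [e6]; exact key

theorem famB (hφ : IsPhi φ) {n p q : ℕ} (h : H φ n) {s t : F} (hs : N s ≤ p) (ht : N t ≤ q)
    (hp : 1 ≤ p) (hq : 1 ≤ q) (hpq : p + q = n) (c : Bool) (k m : ℤ) :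
    fv φ s t c k m = fv φ s t c k (m - 2 * k) := by
  have hl : ∀ i : ℤ, N (g c ^ i * t) ≤ n := fun i => (nm (N_syl c i) ht).trans (by omega)
  have hsl : ∀ i : ℤ, N (s * g c ^ i) ≤ n := fun i => (nm hs (N_syl c i)).trans (by omega)
  have hr : ∀ i : ℤ, N (t⁻¹ * g c ^ i) ≤ n := fun i => (nm (ni ht) (N_syl c i)).trans (by omega)
  have hc : ∀ i : ℤ, N (g c ^ i) ≤ n := fun i => (N_syl c i).trans (by omega)
  have hst : N (s * t) ≤ n := (nm hs ht).trans (by omega)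
  have key := quadB (φ (g c ^ (k - m) * t)) (φ (t⁻¹ * g c ^ (m - 2 * k))) (φ (s * g c ^ m))
    (φ (s * g c ^ (m - 2 * k)))
  have e1 : φ (g c ^ (k - m) * t) * φ (t⁻¹ * g c ^ (m - 2 * k)) = φ (g c ^ (-k)) :=
    Hm h (by group) (hl _) (hr _) (hc _)
  have e2 : φ (t⁻¹ * g c ^ (m - 2 * k)) * φ (g c ^ (-k)) = φ (t⁻¹ * g c ^ (m - 3 * k)) :=
    Hm h (by group) (hr _) (hc _) (hr _)
  have e3 : φ (g c ^ (-k)) * φ (g c ^ (k - m) * t) = φ (g c ^ (- m) * t) :=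
    Hm h (by group) (hc _) (hl _) (hl _)
  have e4 : φ (g c ^ (k - (m - 2 * k)) * t) = (φ (t⁻¹ * g c ^ (m - 3 * k)))⁻¹ :=
    Hi hφ h (by group) (hr _)
  have e5 : φ (g c ^ (2 * k - m) * t) = (φ (t⁻¹ * g c ^ (m - 2 * k)))⁻¹ :=
    Hi hφ h (by group) (hr _)
  rw [ARIF.flex (φ (g c ^ (k - m) * t)), e1, e2, e3, ← e4, ← e5] at key
  unfold fv
  rw [key]
  rw [Hm h (w := s * t) (by group) (hsl _) (hl _) hst,
    Hm h (w := s * t) (by group) (hsl _) (hl _) hst]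

theorem fam_zero {n p q : ℕ} (h : H φ n) {s t : F} (hs : N s ≤ p) (ht : N t ≤ q)
    (hp : 1 ≤ p) (hq : 1 ≤ q) (hpq : p + q = n) (c : Bool) (m m' : ℤ) :
    fv φ s t c 0 m = fv φ s t c 0 m' := by
  have hl : ∀ i : ℤ, N (g c ^ i * t) ≤ n := fun i => (nm (N_syl c i) ht).trans (by omega)
  have hsl : ∀ i : ℤ, N (s * g c ^ i) ≤ n := fun i => (nm hs (N_syl c i)).trans (by omega)
  have hst : N (s * t) ≤ n := (nm hs ht).trans (by omega)
  unfold fv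
  rw [Hm h (w := s * t) (by group) (hsl _) (hl _) hst,
    Hm h (w := s * t) (by group) (hsl _) (hl _) hst]

theorem all_eq_of_succ {A : Type*} (f : ℤ → A) (h : ∀ m, f m = f (m + 1)) (m m' : ℤ) :
    f m = f m' := by
  have h0 : ∀ m : ℤ, f m = f 0 := by
    intro m
    induction m using Int.induction_on with
    | zero => rfl
    | succ i ih => rw [← h, ih]
    | pred i ih => rw [h, sub_add_cancel, ih]
  rw [h0 m, h0 m']

theorem fam_step {P : ℤ → Prop} (h : ∀ k, P k ↔ P (k + 2)) (k : ℤ) (j : ℤ) :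
    P k ↔ P (k + 2 * j) := by
  induction j using Int.induction_on with
  | zero => simp
  | succ i ih => rw [ih, h, show k + 2 * (i : ℤ) + 2 = k + 2 * (i + 1) by ring]
  | pred i ih => rw [ih, h (k + 2 * (-(i : ℤ) - 1)),
      show k + 2 * (-(i : ℤ) - 1) + 2 = k + 2 * (-(i : ℤ)) by ring]

theorem fam_even (hφ : IsPhi φ) {n p q : ℕ} (h : H φ n) {s t : F} (hs : N s ≤ p) (ht : N t ≤ q)
    (hp : 1 ≤ p) (hq : 1 ≤ q) (hpq : p + q = n) (c : Bool) (k : ℤ) (hk : Even k) (m m' : ℤ) :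
    fv φ s t c k m = fv φ s t c k m' := by
  have hst := fam_step (P := fun k => ∀ m, fv φ s t c k m = fv φ s t c k (m + 1)) (fun k =>
    forall_congr' fun m => by simpa using famA hφ h hs ht hp hq hpq c k m 1) 0
  obtain ⟨j, rfl⟩ := hk
  apply all_eq_of_succ
  have := (hst j).1 fun m => fam_zero h hs ht hp hq hpq c _ _
  simpa [two_mul] using this

theorem fam_odd (hφ : IsPhi φ) {n p q : ℕ} (h : H φ n) {s t : F} (hs : N s ≤ p) (ht : N t ≤ q)
    (hp : 1 ≤ p) (hq : 1 ≤ q) (hpq : p + q = n) (c : Bool) (k : ℤ) (hk : Odd k)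
    (h1 : fv φ s t c 1 0 = fv φ s t c 1 1) (m m' : ℤ) :
    fv φ s t c k m = fv φ s t c k m' := by
  have hst := fam_step (P := fun k => ∀ m, fv φ s t c k m = fv φ s t c k (m + 1)) (fun k =>
    forall_congr' fun m => by simpa using famA hφ h hs ht hp hq hpq c k m 1) 1
  obtain ⟨j, rfl⟩ := hk
  apply all_eq_of_succ
  rw [add_comm (2 * j)]
  refine (hst j).1 ?_
  have hB : ∀ m, fv φ s t c 1 m = fv φ s t c 1 (m - 2) := fun m => by
    simpa using famB hφ h hs ht hp hq hpq c 1 m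
  have h0 : ∀ m : ℤ, fv φ s t c 1 m = fv φ s t c 1 (m + 1) := by
    intro m
    induction m using Int.induction_on with
    | zero => simpa using h1
    | succ i ih =>
      rw [← ih, hB (i + 1 + 1)]; congr 1; ring
    | pred i ih =>
      rw [sub_add_cancel, ih, hB (-i + 1)]; congr 1; ring
  exact h0

theorem evenL (hφ : IsPhi φ) {n p q : ℕ} (h : H φ n) {s t : F} (hs : N s ≤ p) (ht : N t ≤ q)
    (hpq : p + q + 3 ≤ n) (c d : Bool) (y' x y x' : ℤ)
    (hb : N (g d ^ (-y) * g c ^ (-x) * g d ^ (-y) * g c ^ (x' - x) * t) ≤ n) :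
    φ (s * g d ^ y' * g c ^ x * g d ^ y) * φ (g c ^ x' * t) =
      φ (s * g d ^ y') * φ (g c ^ x * g d ^ y * g c ^ x' * t) := by
  have b1 : N (g c ^ x' * t) ≤ n := (nm (N_syl c _) ht).trans (by omega)
  have b2 : N (t⁻¹ * g c ^ (-x')) ≤ n := (nm (ni ht) (N_syl c _)).trans (by omega)
  have b3 : N (g d ^ (-y) * g c ^ (x' - x) * t) ≤ n :=
    (nm (nm (N_syl d _) (N_syl c _)) ht).trans (by omega)
  have b4 : N (g d ^ (-y) * g c ^ (-x)) ≤ n := (nm (N_syl d _) (N_syl c _)).trans (by omega)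
  have b5 : N (s * g d ^ y') ≤ n := (nm hs (N_syl d _)).trans (by omega)
  have b6 : N (s * g d ^ y' * g c ^ x * g d ^ y) ≤ n :=
    (nm (nm (nm hs (N_syl d _)) (N_syl c _)) (N_syl d _)).trans (by omega)
  have b7 : N (s * g d ^ (y' - y) * g c ^ (x' - x) * t) ≤ n :=
    (nm (nm (nm hs (N_syl d _)) (N_syl c _)) ht).trans (by omega)
  have b8 : N (t⁻¹ * g c ^ (-x') * g d ^ (-y) * g c ^ (-x)) ≤ n :=
    (nm (nm (nm (ni ht) (N_syl c _)) (N_syl d _)) (N_syl c _)).trans (by omega)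
  have key := quadA (φ (t⁻¹ * g c ^ (-x'))) (φ (g d ^ (-y) * g c ^ (x' - x) * t))
    (φ (s * g d ^ y' * g c ^ x * g d ^ y)) (φ (s * g d ^ y'))
  have e1 : φ (g d ^ (-y) * g c ^ (x' - x) * t) * φ (t⁻¹ * g c ^ (-x')) =
      φ (g d ^ (-y) * g c ^ (-x)) := Hm h (by group) b3 b2 b4
  have e2 : φ (t⁻¹ * g c ^ (-x')) * φ (g d ^ (-y) * g c ^ (-x)) =
      φ (t⁻¹ * g c ^ (-x') * g d ^ (-y) * g c ^ (-x)) := Hm h (by group) b2 b4 b8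
  have e3 : φ (g d ^ (-y) * g c ^ (-x)) * φ (g d ^ (-y) * g c ^ (x' - x) * t) = _ :=
    Hm h (by group) b4 b3 hb
  have e4 : φ (g c ^ x' * t) = (φ (t⁻¹ * g c ^ (-x')))⁻¹ := Hi hφ h (by group) b2
  have e5 : φ (g c ^ x * g d ^ y * g c ^ x' * t) =
      (φ (t⁻¹ * g c ^ (-x') * g d ^ (-y) * g c ^ (-x)))⁻¹ := Hi hφ h (by group) b8
  rw [ARIF.flex (φ (g d ^ (-y) * g c ^ (x' - x) * t)), e1, e2, e3, ← e4, ← e5] at key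
  rw [key, Hm h (w := s * g d ^ (y' - y) * g c ^ (x' - x) * t) (by group) b6 hb b7,
    Hm h (w := s * g d ^ (y' - y) * g c ^ (x' - x) * t) (by group) b5 b3 b7]

theorem endL (hφ : IsPhi φ) {n r : ℕ} (h : H φ n) {t : F} (ht : N t ≤ r)
    (hpq : r + 3 ≤ n) (c d : Bool) (k p m q : ℤ)
    (hv : φ (g c ^ m) * φ (g d ^ p * g c ^ m * g d ^ q * t) =
      φ (g c ^ m * g d ^ p) * φ (g c ^ m * g d ^ q * t)) :
    φ (g c ^ k) * φ (g d ^ p * g c ^ m * g d ^ q * t) =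
      φ (g c ^ k * g d ^ p) * φ (g c ^ m * g d ^ q * t) := by
  have b1 : N (g c ^ m * g d ^ q * t) ≤ n :=
    (nm (nm (N_syl c _) (N_syl d _)) ht).trans (by omega)
  have b2 : N (t⁻¹ * g d ^ (-q) * g c ^ (-m)) ≤ n :=
    (nm (nm (ni ht) (N_syl d _)) (N_syl c _)).trans (by omega)
  have b3 : N (g d ^ (q - p) * t) ≤ n := (nm (N_syl d _) ht).trans (by omega)
  have b4 : N (g d ^ (-p) * g c ^ (-m)) ≤ n := (nm (N_syl d _) (N_syl c _)).trans (by omega)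
  have b5 : N (g c ^ k * g d ^ p) ≤ n := (nm (N_syl c _) (N_syl d _)).trans (by omega)
  have b6 : N (g d ^ (-p) * g c ^ (-m) * g d ^ (q - p) * t) ≤ n :=
    (nm (nm (nm (N_syl d _) (N_syl c _)) (N_syl d _)) ht).trans (by omega)
  have b7 : N (g c ^ (k - m) * g d ^ (q - p) * t) ≤ n :=
    (nm (nm (N_syl c _) (N_syl d _)) ht).trans (by omega)
  have b8 : N (g c ^ (k - m)) ≤ n := (N_syl c _).trans (by omega)
  have key := quadA (φ (t⁻¹ * g d ^ (-q) * g c ^ (-m))) (φ (g d ^ (q - p) * t))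
    (φ (g c ^ k * g d ^ p)) (φ (g c ^ (k - m)))
  have e1 : φ (g d ^ (q - p) * t) * φ (t⁻¹ * g d ^ (-q) * g c ^ (-m)) =
      φ (g d ^ (-p) * g c ^ (-m)) := Hm h (by group) b3 b2 b4
  have e3 : φ (g d ^ (-p) * g c ^ (-m)) * φ (g d ^ (q - p) * t) =
      φ (g d ^ (-p) * g c ^ (-m) * g d ^ (q - p) * t) := Hm h (by group) b4 b3 b6
  have e4 : φ (g c ^ m * g d ^ q * t) = (φ (t⁻¹ * g d ^ (-q) * g c ^ (-m)))⁻¹ :=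
    Hi hφ h (by group) b2
  have e5 : φ (g c ^ m * g d ^ p) = (φ (g d ^ (-p) * g c ^ (-m)))⁻¹ := Hi hφ h (by group) b4
  rw [ARIF.flex (φ (g d ^ (q - p) * t)), e1, e3, mul_inv_rev', ← e4, ← e5] at key
  have key2 := key.2 (by
    rw [Hm h (w := g c ^ (k - m) * g d ^ (q - p) * t) (by group) b5 b6 b7,
      Hm h (w := g c ^ (k - m) * g d ^ (q - p) * t) (by group) b8 b3 b7])
  rw [key2, ← hv]
  obtain ⟨x, hx⟩ := hφ.pow c
  rw [hx, hx, hx, pw_mul_pw_mul, sub_add_cancel]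

theorem pow_aux {n : ℕ} (h : H φ n) (o u : F) (hu : N u ≤ n) (K : ℕ)
    (hb : ∀ i ≤ K, N (o * u ^ i) ≤ n) : φ (o * u ^ K) = φ o * pw (φ u) K := by
  induction K with
  | zero => simp [pw_zero, mul_one']
  | succ K ih =>
    rw [← Hm h (u := o * u ^ K) (v := u) (by rw [pow_succ, mul_assoc]) (hb _ (by omega)) hu
      (hb _ le_rfl), ih fun i hi => hb i (by omega)]
    nth_rewrite 2 [← pw_one (φ u)]
    rw [mul_pw_mul_pw]; push_cast; rfl

theorem N_pow2 (c d : Bool) (k l : ℤ) (K : ℕ) : N ((g c ^ k * g d ^ l) ^ K) ≤ 2 * K := by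
  induction K with
  | zero => simp [N_one]
  | succ K ih =>
    rw [pow_succ]
    exact (nm ih (nm (N_syl c _) (N_syl d _))).trans (by omega)

theorem powerL (hφ : IsPhi φ) {n K : ℕ} (h : H φ n) (hK : 2 * K + 1 ≤ n) (h2 : 2 ≤ n)
    (c d : Bool) (k l : ℤ) :
    φ (g c ^ k) * φ (g d ^ l * (g c ^ k * g d ^ l) ^ K) =
      φ (g c ^ k * g d ^ l) * φ ((g c ^ k * g d ^ l) ^ K) := by
  have bg : N (g c ^ k * g d ^ l) ≤ n := (nm (N_syl c _) (N_syl d _)).trans (by omega)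
  have h1 := pow_aux h (g c ^ (-k)) (g c ^ k * g d ^ l) bg (K + 1) (by
    intro i hi
    cases i with
    | zero => rw [pow_zero, mul_one]; exact (N_syl c _).trans (by omega)
    | succ i =>
      have : g c ^ (-k) * (g c ^ k * g d ^ l) ^ (i + 1) = g d ^ l * (g c ^ k * g d ^ l) ^ i := by
        rw [pow_succ', zpow_neg, mul_assoc, inv_mul_cancel_left]
      rw [this]
      exact (nm (N_syl d _) (N_pow2 c d k l i)).trans (by omega))
  have h3 := pow_aux h (g c ^ k * g d ^ l)⁻¹ (g c ^ k * g d ^ l) bg (K + 1) (by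
    intro i hi
    cases i with
    | zero => rw [pow_zero, mul_one]; exact ni bg
    | succ i =>
      rw [pow_succ', inv_mul_cancel_left]
      exact (N_pow2 c d k l i).trans (by omega))
  rw [pow_succ', inv_mul_cancel_left] at h3
  rw [pow_succ', zpow_neg, mul_assoc, inv_mul_cancel_left] at h1
  rw [h1, h3, Hi hφ h (mul_inv_cancel (g c ^ k * g d ^ l)) bg,
    Hi hφ h (mul_inv_cancel (g c ^ k)) ((N_syl c _).trans (by omega)), lip2, lip2]

theorem endsL (hφ : IsPhi φ) {n : ℕ} (h : H φ n) (hn : 1 ≤ n) {m : F} (hm : N m + 1 ≤ n)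
    (c : Bool) (k l : ℤ) :
    φ (g c ^ k) * φ (m * g c ^ l) = φ (g c ^ k * m) * φ (g c ^ l) := by
  rw [← hφ.syl_mul, ← Hm h (u := m) (v := g c ^ l) rfl (by omega) ((N_syl c _).trans hn)
    ((nm le_rfl (N_syl c _)).trans hm)]
  obtain ⟨x, hx⟩ := hφ.pow c
  rw [hx, hx, pw_flex]

end local_lemmas

section words
variable {M : Type*} [ARIF M] {φ : F → M}

theorem evenL' (hφ : IsPhi φ) {n p q : ℕ} (h : H φ n) {s t : F} (hs : N s ≤ p) (ht : N t ≤ q)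
    (hpq : p + q + 3 ≤ n) (c d : Bool) (y' x y x' : ℤ)
    (hb : N (g c ^ x * g d ^ y * g c ^ x * g d ^ (y - y') * s⁻¹) ≤ n) :
    φ (s * g d ^ y' * g c ^ x * g d ^ y) * φ (g c ^ x' * t) =
      φ (s * g d ^ y') * φ (g c ^ x * g d ^ y * g c ^ x' * t) := by
  have key := evenL hφ h (ni ht) (ni hs) (by omega) d c (-x') (-y) (-x) (-y')
    (by convert hb using 2; group)
  have i1 : φ (t⁻¹ * g c ^ (-x') * g d ^ (-y) * g c ^ (-x)) =
      (φ (g c ^ x * g d ^ y * g c ^ x' * t))⁻¹ := Hi hφ h (by group)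
    ((nm (nm (nm (N_syl c x) (N_syl d y)) (N_syl c x')) ht).trans (by omega))
  have i2 : φ (g d ^ (-y') * s⁻¹) = (φ (s * g d ^ y'))⁻¹ := Hi hφ h (by group)
    ((nm hs (N_syl d y')).trans (by omega))
  have i3 : φ (t⁻¹ * g c ^ (-x')) = (φ (g c ^ x' * t))⁻¹ := Hi hφ h (by group)
    ((nm (N_syl c x') ht).trans (by omega))
  have i4 : φ (g d ^ (-y) * g c ^ (-x) * g d ^ (-y') * s⁻¹) =
      (φ (s * g d ^ y' * g c ^ x * g d ^ y))⁻¹ := Hi hφ h (by group)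
    ((nm (nm (nm hs (N_syl d y')) (N_syl c x)) (N_syl d y)).trans (by omega))
  rw [i1, i2, i3, i4, ← mul_inv_rev', ← mul_inv_rev', inv_inj'] at key
  exact key.symm

theorem endL' (hφ : IsPhi φ) {n r : ℕ} (h : H φ n) {t : F} (ht : N t ≤ r)
    (hpq : r + 3 ≤ n) (c d : Bool) (k p m q : ℤ)
    (hv : φ (t * g d ^ q * g c ^ m) * φ (g d ^ p * g c ^ m) =
      φ (t * g d ^ q * g c ^ m * g d ^ p) * φ (g c ^ m)) :
    φ (t * g d ^ q * g c ^ m) * φ (g d ^ p * g c ^ k) =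
      φ (t * g d ^ q * g c ^ m * g d ^ p) * φ (g c ^ k) := by
  have b1 : N (t * g d ^ q * g c ^ m) ≤ n :=
    (nm (nm ht (N_syl d _)) (N_syl c _)).trans (by omega)
  have b2 : N (t * g d ^ q * g c ^ m * g d ^ p) ≤ n :=
    (nm (nm (nm ht (N_syl d _)) (N_syl c _)) (N_syl d _)).trans (by omega)
  have b3 : ∀ j : ℤ, N (g d ^ p * g c ^ j) ≤ n := fun j => by
    have := nm (N_syl d p) (N_syl c j)
    omega
  have b4 : ∀ j : ℤ, N (g c ^ j) ≤ n := fun j => by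
    have := N_syl c j
    omega
  have i1 : φ (g c ^ (-m) * g d ^ (-q) * t⁻¹) = (φ (t * g d ^ q * g c ^ m))⁻¹ :=
    Hi hφ h (by group) b1
  have i2 : φ (g d ^ (-p) * g c ^ (-m) * g d ^ (-q) * t⁻¹) =
    (φ (t * g d ^ q * g c ^ m * g d ^ p))⁻¹ := Hi hφ h (by group) b2
  have i3 : ∀ j : ℤ, φ (g c ^ (-j) * g d ^ (-p)) = (φ (g d ^ p * g c ^ j))⁻¹ :=
    fun j => Hi hφ h (by group) (b3 j)
  have i4 : ∀ j : ℤ, φ (g c ^ (-j)) = (φ (g c ^ j))⁻¹ := fun j => Hi hφ h (by group) (b4 j)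
  have key := endL hφ h (ni ht) hpq c d (-k) (-p) (-m) (-q) (by
    rw [i1, i2, i3 m, i4 m, ← mul_inv_rev', ← mul_inv_rev', hv])
  rw [i1, i2, i3 k, i4 k, ← mul_inv_rev', ← mul_inv_rev', inv_inj'] at key
  exact key.symm

/-- type of the `i`-th letter -/
def tp (c : Bool) (i : ℕ) : Bool := xor c i.bodd
theorem tp_zero (c : Bool) : tp c 0 = c := by simp [tp]
theorem tp_succ (c : Bool) (i : ℕ) : tp c (i + 1) = !tp c i := by
  simp [tp, Nat.bodd_succ]
theorem tp_two (c : Bool) (i : ℕ) : tp c (i + 2) = tp c i := by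
  rw [tp_succ, tp_succ, Bool.not_not]
theorem tp_add (c : Bool) (i j : ℕ) : tp (tp c i) j = tp c (i + j) := by
  simp [tp, Nat.bodd_add]
theorem tp_even (c : Bool) (j : ℕ) : tp c (2 * j) = c := by
  simp [tp]

/-- initial products -/
def pre (c : Bool) (e : ℕ → ℤ) : ℕ → F
  | 0 => 1
  | i + 1 => pre c e i * g (tp c i) ^ e i

/-- segments -/
def seg (c : Bool) (e : ℕ → ℤ) (i j : ℕ) : F := (pre c e i)⁻¹ * pre c e j

theorem pre_succ (c e i) : pre c e (i + 1) = pre c e i * g (tp c i) ^ e i := rfl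

theorem pre_mul_seg (c e i j) : pre c e i * seg c e i j = pre c e j := by
  simp [seg]

theorem N_seg (c e) (i j : ℕ) (h : i ≤ j) : N (seg c e i j) ≤ j - i := by
  induction j, h using Nat.le_induction with
  | base => simp [seg, N_one]
  | succ j hj ih =>
    have : seg c e i (j + 1) = seg c e i j * g (tp c j) ^ e j := by simp [seg, pre_succ, mul_assoc]
    rw [this]
    exact (nm ih (N_syl _ _)).trans (by omega)

theorem N_pre (c e) (i : ℕ) : N (pre c e i) ≤ i := by
  have := N_seg c e 0 i (by omega)
  simpa [seg, pre] using this

theorem pre_congr (c) {e e' : ℕ → ℤ} (i : ℕ) (h : ∀ j < i, e j = e' j) :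
    pre c e i = pre c e' i := by
  induction i with
  | zero => rfl
  | succ i ih => rw [pre_succ, pre_succ, ih fun j hj => h j (by omega), h i (by omega)]

theorem seg_congr (c) {e e' : ℕ → ℤ} (i j : ℕ) (hij : i ≤ j)
    (h : ∀ k, i ≤ k → k < j → e k = e' k) : seg c e i j = seg c e' i j := by
  induction j, hij using Nat.le_induction with
  | base => simp [seg]
  | succ j hj ih =>
    have : ∀ e, seg c e i (j + 1) = seg c e i j * g (tp c j) ^ e j := fun e => by
      simp [seg, pre_succ, mul_assoc]
    rw [this, this, ih fun k h1 h2 => h k h1 (by omega), h j hj (by omega)]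

/-- values of splits -/
def sv (φ : F → M) (n : ℕ) (c : Bool) (e : ℕ → ℤ) (i : ℕ) : M :=
  φ (pre c e i) * φ (seg c e i (n + 1))

theorem sv_eq {n c e i} {X T : F} (h1 : pre c e i = X) (h2 : X * T = pre c e (n + 1)) :
    sv φ n c e i = φ X * φ T := by
  subst h1
  rw [sv, seg, ← h2, inv_mul_cancel_left]

theorem even_step (hφ : IsPhi φ) {n : ℕ} (h : H φ n) (c : Bool) (e : ℕ → ℤ) (i : ℕ)
    (hi : i + 3 ≤ n)
    (hc : 1 ≤ i ∨ i + 4 ≤ n ∨ e (i + 1) = e (i + 3) ∨ e i = e (i + 2)) :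
    sv φ n c e (i + 1) = sv φ n c e (i + 3) := by
  have t2 : tp c (i + 2) = tp c i := tp_two c i
  have t3 : tp c (i + 3) = tp c (i + 1) := tp_two c (i + 1)
  have hw : pre c e (n + 1) = pre c e i * g (tp c i) ^ e i * g (tp c (i + 1)) ^ e (i + 1) *
      g (tp c i) ^ e (i + 2) * g (tp c (i + 1)) ^ e (i + 3) * seg c e (i + 4) (n + 1) := by
    rw [← pre_mul_seg c e (i + 4) (n + 1), pre_succ c e (i + 3), pre_succ c e (i + 2),
      pre_succ c e (i + 1), pre_succ c e i, t2, t3]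
  rw [sv_eq (X := pre c e i * g (tp c i) ^ e i)
      (T := g (tp c (i + 1)) ^ e (i + 1) * g (tp c i) ^ e (i + 2) * g (tp c (i + 1)) ^ e (i + 3)
        * seg c e (i + 4) (n + 1)) (pre_succ _ _ _) (by rw [hw]; simp only [mul_assoc]),
    sv_eq (X := pre c e i * g (tp c i) ^ e i * g (tp c (i + 1)) ^ e (i + 1) *
      g (tp c i) ^ e (i + 2)) (T := g (tp c (i + 1)) ^ e (i + 3) * seg c e (i + 4) (n + 1))
      (by rw [pre_succ c e (i + 2), pre_succ c e (i + 1), pre_succ c e i, t2])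
      (by rw [hw]; simp only [mul_assoc])]
  have hs := N_pre c e i
  have ht := N_seg c e (i + 4) (n + 1) (by omega)
  symm
  rcases hc with hc | hc | hc | hc
  · apply evenL hφ h hs ht (by omega)
    exact (nm (nm (nm (nm (N_syl _ _) (N_syl _ _)) (N_syl _ _)) (N_syl _ _)) ht).trans (by omega)
  · apply evenL' hφ h hs ht (by omega)
    exact (nm (nm (nm (nm (N_syl _ _) (N_syl _ _)) (N_syl _ _)) (N_syl _ _)) (ni hs)).trans
      (by omega)
  · apply evenL hφ h hs ht (by omega)
    rw [hc, sub_self, zpow_zero, mul_one]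
    exact (nm (nm (nm (N_syl _ _) (N_syl _ _)) (N_syl _ _)) ht).trans (by omega)
  · apply evenL' hφ h hs ht (by omega)
    rw [hc, sub_self, zpow_zero, mul_one]
    exact (nm (nm (nm (N_syl _ _) (N_syl _ _)) (N_syl _ _)) (ni hs)).trans (by omega)

theorem sv_fv {n c e i} (hi : i ≤ n) (k : ℤ) :
    sv φ n c (Function.update e i k) i = fv φ (pre c e i) (seg c e (i + 1) (n + 1)) (tp c i) k 0 ∧
    sv φ n c (Function.update e i k) (i + 1) =
      fv φ (pre c e i) (seg c e (i + 1) (n + 1)) (tp c i) k k := by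
  have h1 : pre c (Function.update e i k) i = pre c e i := pre_congr c i fun j hj => by
    rw [Function.update_of_ne (by omega)]
  have h2 : seg c (Function.update e i k) (i + 1) (n + 1) = seg c e (i + 1) (n + 1) :=
    seg_congr c _ _ (by omega) fun j hj _ => by rw [Function.update_of_ne (by omega)]
  have h3 : pre c (Function.update e i k) (i + 1) = pre c e i * g (tp c i) ^ k := by
    rw [pre_succ, h1, Function.update_self]
  have h4 : pre c (Function.update e i k) (n + 1) =
      pre c e i * g (tp c i) ^ k * seg c e (i + 1) (n + 1) := by
    rw [← pre_mul_seg c _ (i + 1), h2, h3]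
  unfold fv
  constructor
  · apply sv_eq
    · rw [h1]; simp
    · rw [h4]; group
  · apply sv_eq
    · rw [h3]
    · rw [h4]; group

theorem int_step (hφ : IsPhi φ) {n : ℕ} (h : H φ n) (c : Bool) (e : ℕ → ℤ) (i : ℕ)
    (hi : 1 ≤ i) (hin : i + 1 ≤ n)
    (h1 : sv φ n c (Function.update e i 1) i = sv φ n c (Function.update e i 1) (i + 1)) :
    sv φ n c e i = sv φ n c e (i + 1) := by
  have hs := N_pre c e i
  have ht := N_seg c e (i + 1) (n + 1) (by omega)
  rw [(sv_fv (by omega) 1).1, (sv_fv (by omega) 1).2] at h1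
  have hu : Function.update e i (e i) = e := Function.update_eq_self i e
  have k1 := (sv_fv (φ := φ) (n := n) (c := c) (e := e) (i := i) (by omega) (e i)).1
  have k2 := (sv_fv (φ := φ) (n := n) (c := c) (e := e) (i := i) (by omega) (e i)).2
  rw [hu] at k1 k2
  rw [k1, k2]
  rcases Int.even_or_odd (e i) with he | he
  · exact fam_even hφ h hs ht hi (by omega) (by omega) _ _ he _ _
  · exact fam_odd hφ h hs ht hi (by omega) (by omega) _ _ he h1 _ _

theorem end_step (hφ : IsPhi φ) {n : ℕ} (h : H φ n) (hn : 3 ≤ n) (c : Bool) (e : ℕ → ℤ)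
    (h1 : sv φ n c (Function.update e 0 (e 2)) 1 = sv φ n c (Function.update e 0 (e 2)) 2) :
    sv φ n c e 1 = sv φ n c e 2 := by
  have ht := N_seg c e 4 (n + 1) (by omega)
  have key : ∀ k : ℤ, (sv φ n c (Function.update e 0 k) 1 = φ (g c ^ k) * φ (g (!c) ^ e 1 *
      g c ^ e 2 * g (!c) ^ e 3 * seg c e 4 (n + 1))) ∧
      (sv φ n c (Function.update e 0 k) 2 = φ (g c ^ k * g (!c) ^ e 1) * φ (
      g c ^ e 2 * g (!c) ^ e 3 * seg c e 4 (n + 1))) := by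
    intro k
    have h2 : seg c (Function.update e 0 k) 4 (n + 1) = seg c e 4 (n + 1) :=
      seg_congr c _ _ (by omega) fun j hj _ => by rw [Function.update_of_ne (by omega)]
    have hw : pre c (Function.update e 0 k) (n + 1) = g c ^ k * g (!c) ^ e 1 *
      g c ^ e 2 * g (!c) ^ e 3 * seg c e 4 (n + 1) := by
      rw [← pre_mul_seg c _ 4, h2]
      simp [pre, tp_succ, tp_zero]
    constructor
    · apply sv_eq
      · simp [pre, tp_zero]
      · rw [hw]; group
    · apply sv_eq
      · simp [pre, tp_zero, tp_succ]
      · rw [hw]; group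
  have hu : Function.update e 0 (e 0) = e := Function.update_eq_self 0 e
  have k1 := key (e 0)
  rw [hu] at k1
  rw [(key _).1, (key _).2] at h1
  rw [k1.1, k1.2]
  exact endL hφ h ht (by omega) _ _ _ _ _ _ h1

theorem end_step' (hφ : IsPhi φ) {n : ℕ} (h : H φ (n + 3)) (c : Bool) (e : ℕ → ℤ)
    (h1 : sv φ (n + 3) c (Function.update e (n + 3) (e (n + 1))) (n + 2) =
      sv φ (n + 3) c (Function.update e (n + 3) (e (n + 1))) (n + 3)) :
    sv φ (n + 3) c e (n + 2) = sv φ (n + 3) c e (n + 3) := by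
  have ht := N_pre c e n
  have t2 : tp c (n + 2) = tp c n := tp_two c n
  have t3 : tp c (n + 3) = tp c (n + 1) := tp_two c (n + 1)
  have key : ∀ k : ℤ, (sv φ (n + 3) c (Function.update e (n + 3) k) (n + 2) =
      φ (pre c e n * g (tp c n) ^ e n * g (tp c (n + 1)) ^ e (n + 1)) *
      φ (g (tp c n) ^ e (n + 2) * g (tp c (n + 1)) ^ k)) ∧
      (sv φ (n + 3) c (Function.update e (n + 3) k) (n + 3) =
      φ (pre c e n * g (tp c n) ^ e n * g (tp c (n + 1)) ^ e (n + 1) * g (tp c n) ^ e (n + 2)) *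
      φ (g (tp c (n + 1)) ^ k)) := by
    intro k
    have h3 : pre c (Function.update e (n + 3) k) (n + 3) =
      pre c e n * g (tp c n) ^ e n * g (tp c (n + 1)) ^ e (n + 1) * g (tp c n) ^ e (n + 2) := by
      rw [pre_congr c (e' := e) (n + 3) fun j hj => by rw [Function.update_of_ne (by omega)],
        pre_succ, pre_succ, pre_succ, t2]
    have h2 : pre c (Function.update e (n + 3) k) (n + 2) =
      pre c e n * g (tp c n) ^ e n * g (tp c (n + 1)) ^ e (n + 1) := by
      rw [pre_congr c (e' := e) (n + 2) fun j hj => by rw [Function.update_of_ne (by omega)],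
        pre_succ, pre_succ]
    have hw : pre c (Function.update e (n + 3) k) (n + 3 + 1) =
      pre c e n * g (tp c n) ^ e n * g (tp c (n + 1)) ^ e (n + 1) * g (tp c n) ^ e (n + 2) *
      g (tp c (n + 1)) ^ k := by
      rw [pre_succ, h3, t3, Function.update_self]
    exact ⟨sv_eq h2 (by rw [hw]; group), sv_eq h3 (by rw [hw])⟩
  have hu : Function.update e (n + 3) (e (n + 3)) = e := Function.update_eq_self _ e
  have k1 := key (e (n + 3))
  rw [hu] at k1
  rw [(key _).1, (key _).2] at h1
  rw [k1.1, k1.2]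
  exact endL' hφ h ht (by omega) _ _ _ _ _ _ h1

theorem pre_alt (c : Bool) (e : ℕ → ℤ) (k l : ℤ) (K : ℕ)
    (h0 : ∀ j < K, e (2 * j) = k) (h1 : ∀ j < K, e (2 * j + 1) = l) :
    pre c e (2 * K) = (g c ^ k * g (!c) ^ l) ^ K := by
  induction K with
  | zero => simp [pre]
  | succ K ih =>
    rw [show 2 * (K + 1) = 2 * K + 1 + 1 by ring, pre_succ, pre_succ,
      ih (fun j hj => h0 j (by omega)) (fun j hj => h1 j (by omega)), h0 K (by omega),
      h1 K (by omega), tp_succ, tp_even, pow_succ]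
    simp only [mul_assoc]

theorem power_step (hφ : IsPhi φ) {K : ℕ} (hK : 1 ≤ K) (h : H φ (2 * K + 1)) (c : Bool)
    (e : ℕ → ℤ) (k l : ℤ) (h0 : ∀ j < K + 1, e (2 * j) = k) (h1 : ∀ j < K + 1, e (2 * j + 1) = l) :
    sv φ (2 * K + 1) c e 1 = sv φ (2 * K + 1) c e 2 := by
  have hw : pre c e (2 * K + 1 + 1) = (g c ^ k * g (!c) ^ l) ^ (K + 1) :=
    pre_alt c e k l (K + 1) h0 h1
  have e0 := h0 0 (by omega)
  have e1 := h1 0 (by omega)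
  simp only [mul_zero, zero_add] at e0 e1
  rw [sv_eq (X := g c ^ k) (T := g (!c) ^ l * (g c ^ k * g (!c) ^ l) ^ K)
      (by simp [pre, tp_zero, e0]) (by rw [hw, pow_succ']; simp only [mul_assoc]),
    sv_eq (X := g c ^ k * g (!c) ^ l) (T := (g c ^ k * g (!c) ^ l) ^ K)
      (by simp [pre, tp_zero, tp_succ, e0, e1]) (by rw [hw, pow_succ'])]
  exact powerL hφ h le_rfl (by omega) _ _ _ _

theorem ends_step (hφ : IsPhi φ) {K : ℕ} (hK : 1 ≤ K) (h : H φ (2 * K)) (c : Bool)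
    (e : ℕ → ℤ) : sv φ (2 * K) c e 1 = sv φ (2 * K) c e (2 * K) := by
  have h1 : pre c e 1 = g c ^ e 0 := by simp [pre, tp_zero]
  have h2 : pre c e (2 * K) = g c ^ e 0 * seg c e 1 (2 * K) := by rw [← h1, pre_mul_seg]
  have hw : pre c e (2 * K + 1) = g c ^ e 0 * seg c e 1 (2 * K) * g c ^ e (2 * K) := by
    rw [pre_succ, h2, tp_even]
  rw [sv_eq (T := seg c e 1 (2 * K) * g c ^ e (2 * K)) h1 (by rw [hw]; group),
    sv_eq (T := g c ^ e (2 * K)) h2 (by rw [hw])]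
  have := N_seg c e 1 (2 * K) (by omega)
  exact endsL hφ h (by omega) (by omega) _ _ _

end words

section splits
variable {M : Type*} [ARIF M] {φ : F → M}

/-- all splits of the word agree -/
def Vall (φ : F → M) (n : ℕ) (c : Bool) (e : ℕ → ℤ) : Prop :=
  ∀ i, 1 ≤ i → i ≤ n → sv φ n c e i = sv φ n c e 1

theorem parity_link {A : Type*} {f : ℕ → A} {n : ℕ} (h : ∀ i, i + 3 ≤ n → f (i + 1) = f (i + 3)) :
    ∀ i, (2 * i + 1 ≤ n → f (2 * i + 1) = f 1) ∧ (2 * i + 2 ≤ n → f (2 * i + 2) = f 2) := by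
  intro i
  induction i with
  | zero => simp
  | succ i ih =>
    refine ⟨fun hi => ?_, fun hi => ?_⟩
    · rw [← ih.1 (by omega)]; exact (h (2 * i) (by omega)).symm
    · rw [← ih.2 (by omega)]; exact (h (2 * i + 1) (by omega)).symm

theorem link_all {A : Type*} {f : ℕ → A} {n : ℕ} (h : ∀ i, i + 3 ≤ n → f (i + 1) = f (i + 3))
    (j : ℕ) (hj : 1 ≤ j) (hjn : j + 1 ≤ n) (he : f j = f (j + 1)) :
    ∀ i, 1 ≤ i → i ≤ n → f i = f 1 := by
  have hp := parity_link h
  have h12 : f 2 = f 1 := by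
    rcases Nat.even_or_odd' j with ⟨k, hk | hk⟩
    · have h1 := (hp (k - 1)).2 (by omega)
      have h2 := (hp k).1 (by omega)
      rw [show 2 * (k - 1) + 2 = j by omega] at h1
      rw [show 2 * k + 1 = j + 1 by omega] at h2
      rw [← h1, ← h2, he]
    · have h1 := (hp k).2 (by omega)
      have h2 := (hp k).1 (by omega)
      rw [show 2 * k + 2 = j + 1 by omega] at h1
      rw [show 2 * k + 1 = j by omega] at h2
      rw [← h1, ← h2, he]
  intro i hi hin
  rcases Nat.even_or_odd' i with ⟨k, hk | hk⟩
  · have h1 := (hp (k - 1)).2 (by omega)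
    rw [show 2 * (k - 1) + 2 = i by omega] at h1
    rw [h1, h12]
  · have h2 := (hp k).1 (by omega)
    rw [hk, h2]

theorem V3a (hφ : IsPhi φ) (h : H φ 3) (c : Bool) (e : ℕ → ℤ) (h0 : e 0 = e 2) (h1 : e 1 = e 3) :
    sv φ 3 c e 1 = sv φ 3 c e 2 ∧ sv φ 3 c e 1 = sv φ 3 c e 3 := by
  refine ⟨?_, even_step hφ h c e 0 (by omega) (by simp [h0])⟩
  refine power_step (K := 1) hφ le_rfl h c e (e 0) (e 1) ?_ ?_
  · intro j hj
    obtain rfl | rfl : j = 0 ∨ j = 1 := by omega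
    · rfl
    · exact h0.symm
  · intro j hj
    obtain rfl | rfl : j = 0 ∨ j = 1 := by omega
    · rfl
    · exact h1.symm

theorem V3b (hφ : IsPhi φ) (h : H φ 3) (c : Bool) (e : ℕ → ℤ) (h0 : e 0 = e 2) :
    sv φ 3 c e 1 = sv φ 3 c e 2 := by
  have h1 := V3a hφ h c (Function.update e 3 (e 1)) (by simpa using h0) (by simp)
  have h2 : sv φ 3 c e 2 = sv φ 3 c e 3 := end_step' (n := 0) hφ h c e (h1.1.symm.trans h1.2)
  have h3 : sv φ 3 c e 1 = sv φ 3 c e 3 := even_step hφ h c e 0 (by omega) (by simp [h0])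
  rw [h2, h3]

theorem V3c (hφ : IsPhi φ) (h : H φ 3) (c : Bool) (e : ℕ → ℤ) (h1 : e 1 = e 3) :
    sv φ 3 c e 2 = sv φ 3 c e 3 := by
  have h2 := V3a hφ h c (Function.update e 0 (e 2)) (by simp) (by simpa using h1)
  have h3 : sv φ 3 c e 1 = sv φ 3 c e 2 := end_step hφ h le_rfl c e h2.1
  have h4 : sv φ 3 c e 1 = sv φ 3 c e 3 := even_step hφ h c e 0 (by omega) (by simp [h1])
  rw [← h3, h4]

theorem V3 (hφ : IsPhi φ) (h : H φ 3) (c : Bool) (e : ℕ → ℤ) : Vall φ 3 c e := by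
  have h1 : sv φ 3 c e 1 = sv φ 3 c e 2 := end_step hφ h le_rfl c e (V3b hφ h c _ (by simp))
  have h2 : sv φ 3 c e 2 = sv φ 3 c e 3 := end_step' (n := 0) hφ h c e (V3c hφ h c _ (by simp))
  intro i hi hin
  obtain rfl | rfl | rfl : i = 1 ∨ i = 2 ∨ i = 3 := by omega
  · rfl
  · exact h1.symm
  · rw [← h2, h1]

theorem V4 (hφ : IsPhi φ) {n : ℕ} (h : H φ n) (hn : 4 ≤ n) (c : Bool) (e : ℕ → ℤ)
    (j : ℕ) (hj : 1 ≤ j) (hjn : j + 1 ≤ n) (he : sv φ n c e j = sv φ n c e (j + 1)) :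
    Vall φ n c e :=
  link_all (fun i hi => even_step hφ h c e i hi (by omega)) j hj hjn he

theorem V4i (hφ : IsPhi φ) {n : ℕ} (h : H φ n) (hn : 4 ≤ n) (c : Bool) (e : ℕ → ℤ)
    (j : ℕ) (hj : 1 ≤ j) (hjn : j + 1 ≤ n) (he : Vall φ n c (Function.update e j 1)) :
    Vall φ n c e := by
  refine V4 hφ h hn c e j hj hjn (int_step hφ h c e j hj hjn ?_)
  rw [he j hj (by omega), he (j + 1) (by omega) hjn]

theorem Vodd (hφ : IsPhi φ) {K : ℕ} (h : H φ (2 * K + 1)) (hK : 2 ≤ K) (c : Bool) (e : ℕ → ℤ) :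
    Vall φ (2 * K + 1) c e := by
  -- all ones in the interior and at both ends
  have s1 : ∀ e : ℕ → ℤ, (∀ i, i ≤ 2 * K + 1 → e i = 1) → Vall φ (2 * K + 1) c e := by
    intro e he
    refine V4 hφ h (by omega) c e 1 le_rfl (by omega) ?_
    exact power_step hφ (by omega) h c e 1 1 (fun j hj => he _ (by omega))
      (fun j hj => he _ (by omega))
  have s2 : ∀ e : ℕ → ℤ, (∀ i, 1 ≤ i → i ≤ 2 * K + 1 → e i = 1) → Vall φ (2 * K + 1) c e := by
    intro e he
    refine V4 hφ h (by omega) c e 1 le_rfl (by omega) (end_step hφ h (by omega) c e ?_)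
    have := s1 (Function.update e 0 (e 2)) (by
      intro i hi
      by_cases h0 : i = 0
      · subst h0; rw [Function.update_self]; exact he _ (by omega) (by omega)
      · rw [Function.update_of_ne h0]; exact he _ (by omega) hi)
    exact (this 2 (by omega) (by omega)).symm
  have s3 : ∀ e : ℕ → ℤ, (∀ i, 1 ≤ i → i ≤ 2 * K → e i = 1) → Vall φ (2 * K + 1) c e := by
    intro e he
    obtain ⟨n, hn⟩ : ∃ n, 2 * K + 1 = n + 3 := ⟨2 * K - 2, by omega⟩
    have hh := h
    have s2' := s2
    rw [hn] at hh s2' ⊢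
    refine V4 hφ hh (by omega) c e (n + 2) (by omega) (by omega) (end_step' hφ hh c e ?_)
    have := s2' (Function.update e (n + 3) (e (n + 1))) (by
      intro i h0 hi
      by_cases h0 : i = n + 3
      · subst h0; rw [Function.update_self]; exact he _ (by omega) (by omega)
      · rw [Function.update_of_ne h0]; exact he _ (by omega) (by omega))
    rw [this (n + 2) (by omega) (by omega), this (n + 3) (by omega) (by omega)]
  have s4 : ∀ m : ℕ, ∀ e : ℕ → ℤ, (∀ i, 1 + m ≤ i → i ≤ 2 * K → e i = 1) →
      Vall φ (2 * K + 1) c e := by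
    intro m
    induction m with
    | zero => exact s3
    | succ m ih =>
      intro e he
      by_cases hm : 1 + m ≤ 2 * K
      · refine V4i hφ h (by omega) c e (1 + m) (by omega) (by omega) (ih _ ?_)
        intro i hi hik
        by_cases h0 : i = 1 + m
        · subst h0; rw [Function.update_self]
        · rw [Function.update_of_ne h0]; exact he i (by omega) hik
      · exact ih e fun i _ _ => by omega
  exact s4 (2 * K) e fun i _ _ => by omega

theorem Vthm (hφ : IsPhi φ) {n : ℕ} (h : H φ n) (c : Bool) (e : ℕ → ℤ) : Vall φ n c e := by
  rcases Nat.even_or_odd' n with ⟨K, hK | hK⟩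
  · subst hK
    intro i hi hin
    by_cases h1 : K = 1
    · subst h1
      obtain rfl | rfl : i = 1 ∨ i = 2 := by omega
      · rfl
      · exact (ends_step hφ le_rfl h c e).symm
    · have hp := parity_link (f := sv φ (2 * K) c e) (n := 2 * K)
        (fun i hi => even_step hφ h c e i hi (by omega)) (K - 1)
      have h2 := hp.2 (by omega)
      rw [show 2 * (K - 1) + 2 = 2 * K by omega] at h2
      exact V4 hφ h (by omega) c e 1 le_rfl (by omega)
        ((ends_step hφ (by omega) h c e).trans h2) i hi hin
  · subst hK
    obtain rfl | rfl | h2 : K = 0 ∨ K = 1 ∨ 2 ≤ K := by omega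
    · intro i hi hin
      obtain rfl : i = 1 := by omega
      rfl
    · exact V3 hφ h c e
    · exact Vodd hφ h h2 c e

end splits

section splits2
variable {M : Type*} [ARIF M] {φ : F → M}

/-- prepend an exponent -/
def econs (x : ℤ) (e : ℕ → ℤ) : ℕ → ℤ
  | 0 => x
  | k + 1 => e k

theorem pre_econs (c : Bool) (x : ℤ) (e : ℕ → ℤ) (k : ℕ) :
    pre c (econs x e) (k + 1) = g c ^ x * pre (!c) e k := by
  induction k with
  | zero => simp [pre, tp_zero, econs]
  | succ k ih =>
    rw [pre_succ, ih, pre_succ, mul_assoc]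
    congr 3
    have : tp (!c) k = tp c (k + 1) := by rw [← Nat.add_comm 1, ← tp_add]; simp [tp]
    rw [this]

theorem pre_rep (L : List (Bool × ℤ)) : ∀ c : Bool, L.IsChain (fun p q => p.1 ≠ q.1) →
    (∀ p ∈ L.head?, p.1 = c) → ∃ e, ∀ k ≤ L.length, pre c e k = lp (L.take k) := by
  induction L with
  | nil => exact fun c _ _ => ⟨fun _ => 0, fun k hk => by
      obtain rfl : k = 0 := by simpa using hk
      rfl⟩
  | cons p L ih =>
    intro c hL hc
    have hpc : p.1 = c := hc p (by simp)
    obtain ⟨e, he⟩ := ih (!c) hL.tail (by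
      intro q hq
      cases L with
      | nil => simp at hq
      | cons r L =>
        have h1 : p.1 ≠ r.1 := (List.isChain_cons_cons.1 hL).1
        obtain rfl : r = q := by simpa using hq
        rw [hpc] at h1
        revert h1
        generalize r.1 = b
        cases b <;> cases c <;> simp)
    refine ⟨econs p.2 e, fun k hk => ?_⟩
    cases k with
    | zero => rfl
    | succ k => rw [pre_econs, he k (by simpa using hk), List.take_succ_cons, lp_cons, hpc]

theorem split_rep {n i j : ℕ} (u v : F) (hu : N u = i) (hv : N v = j) (hi : 1 ≤ i)
    (hj : 1 ≤ j) (hij : i + j = n + 1) (hw : n < N (u * v)) :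
    ∃ c e, u = pre c e i ∧ u * v = pre c e (n + 1) := by
  obtain ⟨A, hA, rfl⟩ := exists_lp u
  obtain ⟨B, hB, rfl⟩ := exists_lp v
  rw [N_lp hA] at hu
  rw [N_lp hB] at hv
  have hch : (A ++ B).IsChain (fun p q => p.1 ≠ q.1) := by
    refine hA.2.append hB.2 ?_
    intro a ha b hb hab
    obtain ⟨A', rfl⟩ := List.getLast?_eq_some_iff.1 ha
    obtain ⟨B', rfl⟩ := List.head?_eq_some_iff.1 hb
    have : lp (A' ++ [a]) * lp (b :: B') = lp (A' ++ (b.1, a.2 + b.2) :: B') := by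
      simp only [lp_append, lp_cons, lp_nil, hab, zpow_add, mul_one, mul_assoc]
    rw [this] at hw
    have h2 := N_lp_le (A' ++ (b.1, a.2 + b.2) :: B')
    simp only [List.length_append, List.length_cons, List.length_nil] at h2 hu hv
    omega
  obtain ⟨p, A', rfl⟩ : ∃ p A', A = p :: A' := by
    cases A with
    | nil => simp at hu; omega
    | cons p A => exact ⟨p, A, rfl⟩
  obtain ⟨e, he⟩ := pre_rep _ p.1 hch (by simp)
  refine ⟨p.1, e, ?_, ?_⟩
  · rw [he i (by rw [List.length_append]; omega), List.take_left' hu]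
  · rw [he (n + 1) (by rw [List.length_append]; omega), ← lp_append, List.take_of_length_le]
    rw [List.length_append]; omega

theorem splitL (hφ : IsPhi φ) {n : ℕ} (h : H φ n) {u v : F} (huv : N u + N v ≤ n + 1) :
    φ u * φ v = φ (u * v) := by
  by_cases hu : N u = 0
  · rw [N_eq_zero hu, hφ.one, one_mul', one_mul]
  by_cases hv : N v = 0
  · rw [N_eq_zero hv, hφ.one, mul_one', mul_one]
  by_cases hw : N (u * v) ≤ n
  · exact h u v (by omega) (by omega) hw
  have h3 := N_mul u v
  obtain ⟨c, e, h1, h2⟩ := split_rep (n := n) u v rfl rfl (by omega) (by omega) (by omega)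
    (by omega)
  have hV := Vthm hφ h c e (N u) (by omega) (by omega)
  rw [sv_eq h1.symm h2] at hV
  rw [hV, h2, sv, ← pre_mul_seg c e 1 (n + 1)]
  have : pre c e 1 = g c ^ e 0 := by simp [pre, tp_zero]
  rw [this, hφ.syl_mul]

theorem invL (hφ : IsPhi φ) {n : ℕ} (h : H φ n) {u : F} (hu : N u ≤ n + 1) :
    φ u⁻¹ = (φ u)⁻¹ := by
  by_cases h1 : N u ≤ n
  · exact Hi hφ h (mul_inv_cancel u) h1
  obtain ⟨L, hL, rfl⟩ := exists_lp u
  rw [N_lp hL] at hu h1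
  cases L with
  | nil => simp at h1
  | cons p L =>
    have hl := N_lp (red_tail hL)
    simp only [List.length_cons] at hu h1
    rw [lp_cons, mul_inv_rev, ← splitL hφ h, ← splitL hφ h (u := g p.1 ^ p.2), mul_inv_rev']
    · obtain ⟨x, hx⟩ := hφ.pow p.1
      have : φ (g p.1 ^ p.2)⁻¹ = (φ (g p.1 ^ p.2))⁻¹ := by
        rw [← zpow_neg, hx, hx, pw_neg]
      rw [this]
      by_cases hn : L.length ≤ n
      · rw [Hi hφ h (mul_inv_cancel (lp L)) (by omega)]
      · omega
    · have := N_syl p.1 p.2; omega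
    · have := N_syl p.1 p.2; rw [N_inv, N_inv]; omega

end splits2

section tripods
variable {M : Type*} [ARIF M] {φ : F → M}

/-- value of a path through a power of the centre letter -/
def E (φ : F → M) (c : Bool) (a b : F) (i : ℤ) : M := φ (a⁻¹ * g c ^ i * b)

/-- all tripods with given legs are good -/
def TA (φ : F → M) (c : Bool) (a b d : F) : Prop :=
  ∀ i j s : ℤ, i + j = s → E φ c a b i * E φ c b d j = E φ c a d s

/-- inverses for the sides -/
def IA (φ : F → M) (c : Bool) (a b : F) : Prop :=
  ∀ i j : ℤ, j = -i → E φ c b a j = (E φ c a b i)⁻¹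

/-- a single tripod -/
def T (φ : F → M) (c : Bool) (a b d : F) (k m : ℤ) : Prop :=
  E φ c a b k * E φ c b d (m - k) = E φ c a d m

variable {c : Bool} {a b d : F}

theorem T_iff (hi : IA φ c b d) (k m : ℤ) :
    T φ c a b d k m ↔ E φ c a d m * E φ c d b (k - m) = E φ c a b k := by
  rw [hi (m - k) (k - m) (by ring), T]
  constructor
  · intro h; rw [← h, rip]
  · intro h; rw [← h, rip2]

theorem TA_rev (h1 : IA φ c a b) (h2 : IA φ c b d) (h3 : IA φ c a d) (h : TA φ c a b d) :
    TA φ c d b a := by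
  intro i j s hs
  rw [h2 (-i) i (by ring), h1 (-j) j (by ring), ← mul_inv_rev', h (-j) (-i) (-s) (by omega),
    h3 (-s) s (by ring)]

theorem TA_rot (h1 : IA φ c a b) (h3 : IA φ c a d) (h : TA φ c a b d) :
    TA φ c b d a := by
  intro i j s hs
  rw [h1 (-s) s (by ring), h3 (-j) j (by ring), ← h (-s) i (-j) (by omega), mul_inv_rev',
    lip2]

theorem Q1 (hi : IA φ c b d) (s1 : TA φ c b d b) (s2 : TA φ c b b d) (s3 : TA φ c d b b)
    (k m j : ℤ) (t1 : T φ c a b d k m) (t2 : T φ c a b d k (m + j)) :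
    T φ c a b d (k + 2 * j) m ↔ T φ c a b d (k + 2 * j) (m + j) := by
  have key := ARIF.W1 (E φ c b d (m - k)) (E φ c d b (k + j - m)) (E φ c a b k)
  rw [ARIF.flex (E φ c b d (m - k)), s1 (m - k) (k + j - m) j (by ring),
    s2 j (m - k) (m + j - k) (by ring), s3 (k + j - m) j (k + 2 * j - m) (by ring)] at key
  unfold T at t1 t2
  rw [t1, t2] at key
  rw [T_iff hi, T_iff hi, key, show k + 2 * j - (m + j) = k + j - m by ring]

theorem Q2 (hi : IA φ c b d) (s1 : TA φ c b d b) (s2 : TA φ c b b d) (s3 : TA φ c d b b)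
    (k m j : ℤ) (t1 : T φ c a b d k m) (t2 : T φ c a b d (k + j) m) :
    T φ c a b d k (m + 2 * j) ↔ T φ c a b d (k + j) (m + 2 * j) := by
  have key := ARIF.W1 (E φ c d b (k - m)) (E φ c b d (m + j - k)) (E φ c a d m)
  rw [ARIF.flex (E φ c b d (m + j - k)), s1 (m + j - k) (k - m) j (by ring),
    s2 j (m + j - k) (m + 2 * j - k) (by ring), s3 (k - m) j (k + j - m) (by ring)] at key
  rw [T_iff hi] at t1 t2
  rw [t1, t2] at key
  rw [T, T, key, show m + 2 * j - (k + j) = m + j - k by ring]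

theorem int_all {P : ℤ → Prop} (h : ∀ m, P m ↔ P (m + 1)) (h0 : P 0) (m : ℤ) : P m := by
  induction m using Int.induction_on with
  | zero => exact h0
  | succ i ih => exact (h _).1 ih
  | pred i ih => exact (h _).2 (by rwa [sub_add_cancel])

theorem core (hi : IA φ c b d) (s1 : TA φ c b d b) (s2 : TA φ c b b d) (s3 : TA φ c d b b)
    (dg : ∀ k m : ℤ, m = 0 ∨ m = k ∨ k = 0 → T φ c a b d k m) : TA φ c a b d := by
  have f0 : ∀ m, T φ c a b d 0 m := fun m => dg 0 m (by simp)
  have step : ∀ k : ℤ, (∀ m, T φ c a b d k m) ↔ ∀ m, T φ c a b d (k + 2) m := by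
    intro k
    constructor
    · intro hk
      apply int_all _ (dg _ _ (by simp))
      intro m
      simpa using Q1 hi s1 s2 s3 k m 1 (hk _) (hk _)
    · intro hk
      apply int_all _ (dg _ _ (by simp))
      intro m
      have := Q1 hi s1 s2 s3 (k + 2) (m + 1) (-1) (hk _) (hk _)
      simpa using this.symm
  have f1 : ∀ m, T φ c a b d 1 m := by
    have h2 : ∀ m, T φ c a b d 1 m ↔ T φ c a b d 1 (m + 2) := by
      intro m
      constructor
      · intro h
        have := Q2 hi s1 s2 s3 0 m 1 (f0 _) (by simpa using h)
        simpa using this.1 (f0 _)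
      · intro h
        have := Q2 hi s1 s2 s3 1 (m + 2) (-1) h (by simpa using f0 _)
        simpa using this.2 (by simpa using f0 _)
    intro m
    rcases Int.even_or_odd' m with ⟨i, rfl | rfl⟩
    · have := (fam_step h2 0 i).1 (dg _ _ (by simp))
      simpa using this
    · rw [add_comm]
      exact (fam_step h2 1 i).1 (dg _ _ (by simp))
  have all : ∀ k m, T φ c a b d k m := by
    intro k
    rcases Int.even_or_odd' k with ⟨i, rfl | rfl⟩
    · have := (fam_step step 0 i).1 f0
      simpa using this
    · rw [add_comm]
      exact (fam_step step 1 i).1 f1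
  intro i j s hs
  have := all i s
  rwa [T, show s - i = j by omega] at this

theorem NE (a b : F) (c : Bool) (i : ℤ) : N (a⁻¹ * g c ^ i * b) ≤ N a + 1 + N b :=
  nm (nm (ni le_rfl) (N_syl c i)) le_rfl

theorem NE0 (a b : F) (c : Bool) {i : ℤ} (hi : i = 0) : N (a⁻¹ * g c ^ i * b) ≤ N a + N b := by
  rw [hi, zpow_zero, mul_one]
  exact nm (ni le_rfl) le_rfl

/-- goodness up to perimeter `S` -/
def PS (φ : F → M) (n S : ℕ) : Prop :=
  ∀ u v, N u ≤ n + 1 → N v ≤ n + 1 → N (u * v) ≤ n + 1 → N u + N v + N (u * v) ≤ S →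
    φ u * φ v = φ (u * v)

theorem IA_of (hφ : IsPhi φ) {n : ℕ} (h : H φ n) (c : Bool) (a b : F) (hab : N a + N b ≤ n) :
    IA φ c a b := by
  intro i j hj
  rw [E, E, ← invL hφ h ((NE a b c i).trans (by omega)), hj]
  congr 1
  group

theorem PSm {n S : ℕ} (hS : PS φ n S) {u v w : F} (e : u * v = w) (hu : N u ≤ n + 1)
    (hv : N v ≤ n + 1) (hw : N w ≤ n + 1) (hs : N u + N v + N w ≤ S) : φ u * φ v = φ w := by
  subst e; exact hS u v hu hv hw hs

theorem deg_good {n S : ℕ} (hS : PS φ n S) (c : Bool) (a b d : F)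
    (hab : N a + N b ≤ n) (hbd : N b + N d ≤ n) (had : N a + N d ≤ n)
    (hs : 2 * (N a + N b + N d) + 2 ≤ S) (k m : ℤ) (hkm : m = 0 ∨ m = k ∨ k = 0) :
    T φ c a b d k m := by
  have h1 := NE a b c k
  have h2 := NE b d c (m - k)
  have h3 := NE a d c m
  refine PSm hS (by group) (by omega) (by omega) (by omega) ?_
  rcases hkm with h | h | h
  · have := NE0 a d c h
    omega
  · have := NE0 b d c (i := m - k) (by omega)
    omega
  · have := NE0 a b c h
    omega

theorem TA_H {n : ℕ} (h : H φ n) (c : Bool) (a b d : F)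
    (hab : N a + N b + 1 ≤ n) (hbd : N b + N d + 1 ≤ n) (had : N a + N d + 1 ≤ n) :
    TA φ c a b d := by
  intro i j s hs
  have h1 := NE a b c i
  have h2 := NE b d c j
  have h3 := NE a d c s
  refine Hm h (by rw [← hs]; group) (by omega) (by omega) (by omega)

theorem TA_same (hφ : IsPhi φ) {n S : ℕ} (hS : PS φ n S) (c : Bool) (b : F)
    (hb : 2 * N b ≤ n) (hs : 6 * N b + 2 ≤ S) : TA φ c b b b := by
  by_cases h0 : N b = 0
  · obtain rfl := N_eq_zero h0
    obtain ⟨x, hx⟩ := hφ.pow c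
    intro i j s hs
    simp only [E, inv_one, one_mul, mul_one]
    rw [hx, hx, hx, pw_add, hs]
  have nb : ∀ i : ℤ, N (g c ^ i * b) ≤ 1 + N b := fun i => N_syl_mul c i b
  have ne : ∀ i : ℤ, N (b⁻¹ * g c ^ i * b) ≤ N b + 1 + N b := NE b b c
  have h1 : ∀ i : ℤ, φ (g c ^ i * b) * φ (b⁻¹ * g c ^ (1 : ℤ) * b) = φ (g c ^ (i + 1) * b) := by
    intro i
    have a1 := nb i
    have a2 := nb (i + 1)
    have a3 := ne 1
    exact PSm hS (by group) (by omega) (by omega) (by omega) (by omega)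
  have h2 : ∀ i : ℤ, φ b * φ (b⁻¹ * g c ^ i * b) = φ (g c ^ i * b) := by
    intro i
    have a1 := nb i
    have a3 := ne i
    exact PSm hS (by group) (by omega) (by omega) (by omega) (by omega)
  have h3 : ∀ i : ℤ, φ (g c ^ i * b) = φ b * pw (φ (b⁻¹ * g c ^ (1 : ℤ) * b)) i := by
    apply int_all
    · intro i
      rw [← h1 i]
      nth_rewrite 2 [← pw_one (φ (b⁻¹ * g c ^ (1 : ℤ) * b))]
      rw [← mul_pw_mul_pw, mul_cancel_right']
    · rw [pw_zero, mul_one', zpow_zero, one_mul]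
  have h4 : ∀ i : ℤ, E φ c b b i = pw (φ (b⁻¹ * g c ^ (1 : ℤ) * b)) i := by
    intro i
    rw [← mul_cancel_left' (x := φ b), ← h3, ← h2, E]
  intro i j s hs
  rw [h4, h4, h4, pw_add, hs]

/-- the main tripod lemma, middle word minimal -/
theorem TA_min (hφ : IsPhi φ) {n S : ℕ} (h : H φ n) (hS : PS φ n S) (c : Bool) (a b d : F)
    (hab : N a + N b ≤ n) (hbd : N b + N d ≤ n) (had : N a + N d ≤ n)
    (hs : 2 * (N a + N b + N d) + 2 ≤ S) (h1 : N b ≤ N a) (h2 : N b ≤ N d) :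
    TA φ c a b d := by
  by_cases c1 : N b + N d + 1 ≤ n
  · exact core (IA_of hφ h c b d hbd) (TA_H h c _ _ _ (by omega) (by omega) (by omega))
      (TA_H h c _ _ _ (by omega) (by omega) (by omega))
      (TA_H h c _ _ _ (by omega) (by omega) (by omega)) (deg_good hS c a b d hab hbd had hs)
  by_cases c2 : N b + N a + 1 ≤ n
  · refine TA_rev (IA_of hφ h c _ _ (by omega)) (IA_of hφ h c _ _ (by omega))
      (IA_of hφ h c _ _ (by omega)) ?_
    exact core (IA_of hφ h c _ _ (by omega)) (TA_H h c _ _ _ (by omega) (by omega) (by omega))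
      (TA_H h c _ _ _ (by omega) (by omega) (by omega))
      (TA_H h c _ _ _ (by omega) (by omega) (by omega))
      (deg_good hS c d b a (by omega) (by omega) (by omega) (by omega))
  have t1 : TA φ c b b b := TA_same hφ hS c b (by omega) (by omega)
  have t2 : TA φ c d b b := core (IA_of hφ h c _ _ (by omega)) t1 t1 t1
    (deg_good hS c d b b (by omega) (by omega) (by omega) (by omega))
  have i1 : IA φ c d b := IA_of hφ h c _ _ (by omega)
  have i2 : IA φ c b d := IA_of hφ h c _ _ (by omega)
  have i3 : IA φ c b b := IA_of hφ h c _ _ (by omega)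
  have t3 : TA φ c b b d := TA_rot i1 i1 t2
  have t4 : TA φ c b d b := TA_rot i3 i2 t3
  exact core i2 t4 t3 t2 (deg_good hS c a b d hab hbd had hs)

theorem TA_all (hφ : IsPhi φ) {n S : ℕ} (h : H φ n) (hS : PS φ n S) (c : Bool) (a b d : F)
    (hab : N a + N b ≤ n) (hbd : N b + N d ≤ n) (had : N a + N d ≤ n)
    (hs : 2 * (N a + N b + N d) + 2 ≤ S) : TA φ c a b d := by
  by_cases h1 : N b ≤ N a ∧ N b ≤ N d
  · exact TA_min hφ h hS c a b d hab hbd had hs h1.1 h1.2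
  have ia : ∀ x y, N x + N y ≤ n → IA φ c x y := fun x y hxy => IA_of hφ h c x y hxy
  by_cases h2 : N a ≤ N d
  · exact TA_rot (ia _ _ (by omega)) (ia _ _ (by omega))
      (TA_min hφ h hS c d a b (by omega) (by omega) (by omega) (by omega) (by omega) (by omega))
  · exact TA_rot (ia _ _ (by omega)) (ia _ _ (by omega))
      (TA_rot (ia _ _ (by omega)) (ia _ _ (by omega))
      (TA_min hφ h hS c b d a (by omega) (by omega) (by omega) (by omega) (by omega) (by omega)))

theorem PS_succ (hφ : IsPhi φ) {n S : ℕ} (h : H φ n) (hS : PS φ n S) : PS φ n (S + 1) := by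
  intro u v hu hv hw hs
  rcases triangle_struct u v with h1 | h1 | h1 | ⟨c, i, j, α, β, t, rfl, rfl, h2, h3, h4⟩
  · exact splitL hφ h (by omega)
  · have := splitL hφ h (u := u⁻¹) (v := u * v) (by rw [N_inv]; omega)
    rw [inv_mul_cancel_left, invL hφ h hu] at this
    rw [← this, lip2]
  · have := splitL hφ h (u := u * v) (v := v⁻¹) (by rw [N_inv]; omega)
    rw [mul_inv_cancel_right, invL hφ h hv] at this
    rw [← this, rip2]
  · have := TA_all hφ h hS c α t β (by omega) (by omega) (by omega) (by omega) i j _ rfl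
    unfold E at this
    rw [this]
    congr 1
    group

theorem H_succ (hφ : IsPhi φ) {n : ℕ} (h : H φ n) : H φ (n + 1) := by
  have hp : ∀ S, PS φ n S := by
    intro S
    induction S with
    | zero =>
      intro u v _ _ _ hs
      rw [N_eq_zero (u := u) (by omega), N_eq_zero (u := v) (by omega), hφ.one, one_mul', one_mul,
        hφ.one]
    | succ S ih => exact PS_succ hφ h ih
  intro u v hu hv hw
  exact hp _ u v hu hv hw le_rfl

theorem H_all (hφ : IsPhi φ) (n : ℕ) : H φ n := by
  induction n with
  | zero =>
    intro u v hu hv _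
    rw [N_eq_zero (u := u) (by omega), N_eq_zero (u := v) (by omega), hφ.one, one_mul', one_mul,
        hφ.one]
  | succ n ih => exact H_succ hφ ih

theorem phi_mul (hφ : IsPhi φ) (u v : F) : φ u * φ v = φ (u * v) :=
  H_all hφ (max (max (N u) (N v)) (N (u * v))) u v (by simp) (by simp) (by simp)

end tripods

section final
variable {M : Type*} [ARIF M]

/-- action of the free group by left translations -/
def act (gv : Bool → M) : F →* Equiv.Perm M :=
  Monoid.CoprodI.lift (fun c => zpowersHom (Equiv.Perm M) (Lp (gv c)))

theorem act_syl (gv : Bool → M) (c : Bool) (i : ℤ) : act gv (g c ^ i) = Lp (gv c) ^ i := by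
  rw [g_zpow, act, Monoid.CoprodI.lift_of]
  simp

theorem isPhi_act (gv : Bool → M) : IsPhi (fun u => act gv u 1) where
  one := by simp
  syl := ⟨gv, fun c i u => by
    simp only [map_mul, act_syl, ← Lp_pw, Equiv.Perm.mul_apply, Lp_apply]⟩

theorem diassoc (a b x y z : M) (hx : Loop.genBy a b x) (hy : Loop.genBy a b y)
    (hz : Loop.genBy a b z) : (x * y) * z = x * (y * z) := by
  obtain ⟨φ, hφ, ha, hb⟩ : ∃ φ : F → M, IsPhi φ ∧ (∃ u, φ u = a) ∧ ∃ u, φ u = b := by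
    refine ⟨_, isPhi_act (fun c => bif c then a else b), ⟨g true ^ (1 : ℤ), ?_⟩,
      ⟨g false ^ (1 : ℤ), ?_⟩⟩
    · rw [act_syl]; simp [mul_one']
    · rw [act_syl]; simp [mul_one']
  have hinv : ∀ u, φ u⁻¹ = (φ u)⁻¹ := fun u => by
    apply inv_unique
    rw [phi_mul hφ, mul_inv_cancel, hφ.one]
  have key : ∀ w, Loop.genBy a b w → ∃ u, φ u = w := by
    intro w hw
    induction hw with
    | one => exact ⟨1, hφ.one⟩
    | fst => exact ha
    | snd => exact hb
    | mul _ _ h1 h2 =>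
      obtain ⟨u, rfl⟩ := h1
      obtain ⟨v, rfl⟩ := h2
      exact ⟨u * v, (phi_mul hφ u v).symm⟩
    | ld _ _ h1 h2 =>
      obtain ⟨u, rfl⟩ := h1
      obtain ⟨v, rfl⟩ := h2
      refine ⟨u⁻¹ * v, ?_⟩
      rw [← phi_mul hφ, hinv, ← mul_cancel_left' (x := φ u), lip2, Loop.mul_ld]
    | rd _ _ h1 h2 =>
      obtain ⟨u, rfl⟩ := h1
      obtain ⟨v, rfl⟩ := h2
      refine ⟨u * v⁻¹, ?_⟩
      rw [← phi_mul hφ, hinv, ← mul_cancel_right' (x := φ v), rip2, Loop.rd_mul]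
  obtain ⟨u, rfl⟩ := key x hx
  obtain ⟨v, rfl⟩ := key y hy
  obtain ⟨w, rfl⟩ := key z hz
  rw [phi_mul hφ, phi_mul hφ, phi_mul hφ, phi_mul hφ, mul_assoc]

end final

end ArifProof

/-- Every ARIF loop is diassociative: the subloop generated by any two
elements is associative (hence a group). -/
theorem arif_diassociative {M : Type*} [Loop M]
    (hflex : ∀ x y : M, x * (y * x) = (x * y) * x)
    (hW1 : ∀ x y z : M, (z * x) * (y * (x * y)) = (z * (x * (y * x))) * y)
    (hW2 : ∀ x y z : M, (y * (x * y)) * (x * z) = y * ((x * (y * x)) * z)) :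
    ∀ a b x y z : M, Loop.genBy a b x → Loop.genBy a b y → Loop.genBy a b z →
      (x * y) * z = x * (y * z) := by
  let _ : ArifProof.ARIF M := { ‹Loop M› with flex := hflex, W1 := hW1, W2 := hW2 }
  intro a b x y z hx hy hz
  exact ArifProof.diassoc a b x y z hx hy hz
end
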